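/- Let n ≥ 2 and let X ⊂ P^{2n} be an n-dimensional integral nondegenerate variety whose secant variety σ_2(X) equals P^{2n}. For a general point q ∈ P^{2n}, the Segre locus 𝔖(Γ_q(X)) of the entry locus Γ_q(X) has dimension at most 2, and every two-dimensional irreducible component Π of 𝔖(Γ_q(X)) is a plane spanned by the union of the components of Γ_q(X) contained in Π. -/

import Mathlib

open MvPolynomial

noncomputable section

namespace EL

variable {k : Type} [Field k] {n : ℕ}

/-- Projective space of (vector) dimension `n` over `k`. -/
abbrev PS (k : Type) [Field k] (n : ℕ) : Type := Projectivization k (Fin n → k)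

/-- Projective vanishing set of a polynomial (intended to be homogeneous). -/
def V0 (f : MvPolynomial (Fin n) k) : Set (PS k n) :=
  {p | ∀ (v : Fin n → k) (hv : v ≠ 0), Projectivization.mk k v hv = p → eval v f = 0}

/-- The Zariski topology on projective space, generated by complements of vanishing
sets of homogeneous polynomials. -/
instance : TopologicalSpace (PS k n) :=
  TopologicalSpace.generateFrom
    {U | ∃ (d : ℕ) (f : MvPolynomial (Fin n) k), f.IsHomogeneous d ∧ U = (V0 f)ᶜ}

/-- The linear span (as a submodule of the cone) of a set of projective points. -/
def pspan (S : Set (PS k n)) : Submodule k (Fin n → k) := ⨆ p ∈ S, p.submodule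

/-- The projective linear subspace associated to a submodule. -/
def linSet (W : Submodule k (Fin n → k)) : Set (PS k n) := {p | p.submodule ≤ W}

/-- `q` lies in the projective span of `S`. -/
def memSpan (q : PS k n) (S : Set (PS k n)) : Prop := q.submodule ≤ pspan S

/-- The projective dimension of the span of `S`. -/
def spanDim (S : Set (PS k n)) : ℕ := Module.finrank k ↥(pspan S) - 1

/-- `S` is nondegenerate (spans the ambient projective space). -/
def Nondeg (S : Set (PS k n)) : Prop := pspan S = ⊤

/-- `S` is a projective linear subspace of projective dimension `d`. -/
def IsLin (S : Set (PS k n)) (d : ℕ) : Prop :=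
  ∃ W : Submodule k (Fin n → k), Module.finrank k ↥W = d + 1 ∧ S = linSet W

/-- Dimension of a subset, as topological Krull dimension. -/
def pdim (S : Set (PS k n)) : WithBot ℕ∞ := topologicalKrullDim ↥S

/-- An integral (sub)variety: an irreducible Zariski-closed set. -/
def IsVariety (S : Set (PS k n)) : Prop := IsClosed S ∧ IsIrreducible S

/-- A property holds for a general point of projective space. -/
def Generic (P : PS k n → Prop) : Prop :=
  ∃ U : Set (PS k n), IsOpen U ∧ Dense U ∧ ∀ q ∈ U, P q

/-- A property holds for a general point of the set `S`. -/
def GenericIn (S : Set (PS k n)) (P : PS k n → Prop) : Prop :=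
  ∃ U : Set (PS k n), IsOpen U ∧ S ⊆ closure (S ∩ U) ∧ ∀ q ∈ S ∩ U, P q

/-- A property holds for a general tuple of points of projective space. -/
def GenericP {ι : Type} (P : (ι → PS k n) → Prop) : Prop :=
  ∃ U : Set (ι → PS k n), IsOpen U ∧ Dense U ∧ ∀ z ∈ U, P z

/-- `q` is spanned by some `s` points of `X`. -/
def hasDecomp (X : Set (PS k n)) (q : PS k n) (s : ℕ) : Prop :=
  ∃ A : Finset (PS k n), ↑A ⊆ X ∧ A.card = s ∧ memSpan q ↑A

/-- The `X`-rank of a point `q`. -/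
def rk (X : Set (PS k n)) (q : PS k n) : ℕ := sInf {s | hasDecomp X q s}

/-- `A` irredundantly spans `q`. -/
def Irredundant (q : PS k n) (A : Finset (PS k n)) : Prop :=
  memSpan q ↑A ∧ ∀ B : Finset (PS k n), B ⊂ A → ¬ memSpan q ↑B

/-- The set `𝒮(X,q)` of minimal irredundant decompositions of `q` by points of `X`. -/
def decomps (X : Set (PS k n)) (q : PS k n) : Set (Finset (PS k n)) :=
  {A | ↑A ⊆ X ∧ A.card = rk X q ∧ Irredundant q A}

/-- The entry locus of `q` with respect to `X`. -/
def entryLocus (X : Set (PS k n)) (q : PS k n) : Set (PS k n) :=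
  closure (⋃ A ∈ decomps X q, (↑A : Set (PS k n)))

/-- The `s`-th secant variety of `X`. -/
def secant (X : Set (PS k n)) (s : ℕ) : Set (PS k n) :=
  closure {q | hasDecomp X q s}

/-- The generic `X`-rank: least `s` whose secant fills the span of `X`. -/
def rgen (X : Set (PS k n)) : ℕ := sInf {s | secant X s = linSet (pspan X)}

/-- Type I: the general entry locus is irreducible. -/
def TypeI (X : Set (PS k n)) : Prop := Generic (fun q => IsIrreducible (entryLocus X q))

/-- Type II: the general entry locus is reducible. -/
def TypeII (X : Set (PS k n)) : Prop := Generic (fun q => ¬ IsIrreducible (entryLocus X q))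

/-- Type A: the entry locus does not change at a general point of its span. -/
def TypeA (X : Set (PS k n)) : Prop :=
  Generic (fun q => GenericIn (linSet (pspan (entryLocus X q)))
    (fun o => entryLocus X o = entryLocus X q))

/-- `S` (of dimension `m`) has degree `d`: `d` is the largest finite number of points cut
on `S` by a linear subspace of complementary dimension. -/
def HasDegree (S : Set (PS k n)) (m d : ℕ) : Prop :=
  IsGreatest {t | ∃ L : Set (PS k n), IsLin L (n - 1 - m) ∧ (S ∩ L).Finite ∧
    (S ∩ L).ncard = t} d

/-- All secant varieties of `Y` (of dimension `m`) have the expected dimension. -/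
def NonDefective (Y : Set (PS k n)) (m : ℕ) : Prop :=
  ∀ s : ℕ, 1 ≤ s →
    pdim (secant Y s) = ((min ((m+1)*s - 1) (spanDim Y) : ℕ) : WithBot ℕ∞)

/-- `π_o(T) ⊆ π_o(Y)`: every point of `T` (other than `o`) is collinear with `o`
and a point of `Y`. -/
def projLE (o : PS k n) (T Y : Set (PS k n)) : Prop :=
  ∀ t ∈ T, t ≠ o → ∃ y ∈ Y, t.submodule ≤ o.submodule ⊔ y.submodule

/-- A Segre point of the pair `(Y,T)`: projection from `o` maps `Y` and `T`
onto the same set. -/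
def SegrePtPair (Y T : Set (PS k n)) (o : PS k n) : Prop :=
  o ∉ Y ∪ T ∧ projLE o Y T ∧ projLE o T Y

/-- A Segre point of `Y`: the projection from `o` is non-birational on `Y`
(it is not generically injective). -/
def SegrePt (Y : Set (PS k n)) (o : PS k n) : Prop :=
  o ∉ Y ∧ ¬ GenericIn Y (fun y => ∀ y' ∈ Y, y'.submodule ≤ o.submodule ⊔ y.submodule → y' = y)

/-- The Segre locus of `Y`. -/
def segreLocus (Y : Set (PS k n)) : Set (PS k n) := closure {o | SegrePt Y o}

/-- `X` is a cone with vertex `v`. -/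
def IsCone (X : Set (PS k n)) (v : PS k n) : Prop :=
  ∀ p ∈ X, ∀ q : PS k n, q.submodule ≤ v.submodule ⊔ p.submodule → q ∈ X

/-- The homogeneous polynomials vanishing on `X`. -/
def homogCut (X : Set (PS k n)) : Set (MvPolynomial (Fin n) k) :=
  {f | (∃ d, f.IsHomogeneous d) ∧ X ⊆ V0 f}

/-- The span of the gradients at `p` of homogeneous polynomials vanishing on `X`. -/
def gradSpan (X : Set (PS k n)) (p : PS k n) : Submodule k (Fin n → k) :=
  Submodule.span k ((fun f => fun i => eval p.rep (pderiv i f)) '' homogCut X)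

/-- Smoothness at a point of an `m`-dimensional subvariety (Jacobian criterion). -/
def IsSmoothPt (X : Set (PS k n)) (m : ℕ) (p : PS k n) : Prop :=
  Module.finrank k ↥(gradSpan X p) = n - (m + 1)

/-- `X` (of dimension `m`) has only isolated singularities. -/
def IsolatedSings (X : Set (PS k n)) (m : ℕ) : Prop :=
  {p ∈ X | ¬ IsSmoothPt X m p}.Finite

/-- `X` (of dimension `m`) is smooth. -/
def IsSmoothVar (X : Set (PS k n)) (m : ℕ) : Prop := ∀ p ∈ X, IsSmoothPt X m p

/-- The hyperplane (as a submodule) determined by a point of the dual projective space. -/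
def hypSub (a : PS k n) : Submodule k (Fin n → k) :=
  LinearMap.ker (∑ i, a.rep i • (LinearMap.proj i : (Fin n → k) →ₗ[k] k))

/-- The hyperplane determined by a point of the dual projective space. -/
def hypOf (a : PS k n) : Set (PS k n) := linSet (hypSub a)

/-- The (geometric) genus of a space curve `C`, defined by the node count of a
projection from a general point of its span: a general point of `⟨C⟩` lies on
`(d-1)(d-2)/2 - g` secant lines of `C`. -/
def HasGenus (C : Set (PS k n)) (g : ℕ) : Prop :=
  ∃ d : ℕ, HasDegree C 1 d ∧
    GenericIn (linSet (pspan C)) (fun q =>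
      2 * (decomps C q).ncard + 2 * g + 3 * d = d * d + 2)

/-- The embedded tangent space of `X` at `p` (as a submodule of the cone). -/
def tangentSub (X : Set (PS k n)) (p : PS k n) : Submodule k (Fin n → k) :=
  ⨅ f ∈ homogCut X,
    LinearMap.ker (∑ i, (eval p.rep (pderiv i f)) • (LinearMap.proj i : (Fin n → k) →ₗ[k] k))

/-- A curve is tangentially degenerate if its general tangent line meets the
curve elsewhere. -/
def TangDeg (X : Set (PS k n)) : Prop :=
  GenericIn {p ∈ X | IsSmoothPt X 1 p}
    (fun p => ∃ y ∈ X, y ≠ p ∧ y.submodule ≤ tangentSub X p)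

/-- The homogeneous ideal of `X`. -/
def projIdeal (X : Set (PS k n)) : Ideal (MvPolynomial (Fin n) k) :=
  Ideal.span {f | X ⊆ V0 f}

/-- `X` is a normal variety: its homogeneous coordinate ring is integrally closed
in its total fraction ring. -/
def IsNormalVar (X : Set (PS k n)) : Prop :=
  ∀ x : FractionRing (MvPolynomial (Fin n) k ⧸ projIdeal X),
    IsIntegral (MvPolynomial (Fin n) k ⧸ projIdeal X) x →
      ∃ y : MvPolynomial (Fin n) k ⧸ projIdeal X,
        algebraMap (MvPolynomial (Fin n) k ⧸ projIdeal X)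
          (FractionRing (MvPolynomial (Fin n) k ⧸ projIdeal X)) y = x

/-- `C` is an irreducible component of `Y`. -/
def IsCompOf (C Y : Set (PS k n)) : Prop :=
  Maximal (fun Z => Z ⊆ Y ∧ IsIrreducible Z) C

/-- The image of `X` under the linear projection from (the linear space of) `W`,
realized inside the complementary linear space of `Λ`. -/
def projFrom (W Λ : Submodule k (Fin n → k)) (X : Set (PS k n)) : Set (PS k n) :=
  {y | y.submodule ≤ Λ ∧ ∃ x ∈ X, y.submodule ≤ W ⊔ x.submodule}

/-- Decompositions of `q` as irredundant spans of one point from each `Xs i`. -/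
def tupleDecomps {s : ℕ} (Xs : Fin s → Set (PS k n)) (q : PS k n) :
    Set (Fin s → PS k n) :=
  {p | (∀ i, p i ∈ Xs i) ∧ Function.Injective p ∧ memSpan q (Set.range p) ∧
    ∀ i, ¬ memSpan q (Set.range p \ {p i})}

/-- The entry locus of `q` with respect to the tuple of varieties `Xs`. -/
def entryLocusT {s : ℕ} (Xs : Fin s → Set (PS k n)) (q : PS k n) : Set (PS k n) :=
  closure (⋃ p ∈ tupleDecomps Xs q, Set.range p)

/-- The join of the varieties `Xs`. -/
def joinT {s : ℕ} (Xs : Fin s → Set (PS k n)) : Set (PS k n) :=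
  closure {q | ∃ p : Fin s → PS k n, (∀ i, p i ∈ Xs i) ∧ memSpan q (Set.range p)}

/-- Relation `q = F(p)` for a tuple `F` of homogeneous polynomials of the same degree. -/
def polyMapRel {N M : ℕ} (F : Fin M → MvPolynomial (Fin N) k) (p : PS k N) (q : PS k M) :
    Prop :=
  q.submodule = Submodule.span k {fun j => eval p.rep (F j)}

/-- `A` and `B` are isomorphic via mutually inverse polynomial maps. -/
def IsPolyIso {N M : ℕ} (A : Set (PS k N)) (B : Set (PS k M)) : Prop :=
  ∃ (d e : ℕ) (F : Fin M → MvPolynomial (Fin N) k) (G : Fin N → MvPolynomial (Fin M) k),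
    (∀ j, (F j).IsHomogeneous d) ∧ (∀ i, (G i).IsHomogeneous e) ∧
    (∀ p ∈ A, ∃ q ∈ B, polyMapRel F p q ∧ polyMapRel G q p) ∧
    (∀ q ∈ B, ∃ p ∈ A, polyMapRel F p q ∧ polyMapRel G q p)

/-- `A` and `B` are birational: polynomially isomorphic on dense open subsets. -/
def Birational (A B : Set (PS k n)) : Prop :=
  ∃ U V : Set (PS k n), IsOpen U ∧ IsOpen V ∧
    A ⊆ closure (A ∩ U) ∧ B ⊆ closure (B ∩ V) ∧ IsPolyIso (A ∩ U) (B ∩ V)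

/-- A finite set `S` imposes independent conditions on hypersurfaces of degree `i`. -/
def ImposesIndep (S : Finset (PS k n)) (i : ℕ) : Prop :=
  Function.Surjective (fun f : ↥(homogeneousSubmodule (Fin n) k i) =>
    fun p : ↥(↑S : Set (PS k n)) => eval (↑p : PS k n).rep (↑f : MvPolynomial (Fin n) k))

end EL

namespace EL

section Affine

variable {k : Type} [Field k] {σ τ : Type}

theorem trdeg_lt_of_surjective {A B : Type} [CommRing A] [CommRing B] [IsDomain A] [IsDomain B]
    [Algebra k A] [Algebra k B] (f : A →ₐ[k] B) (hf : Function.Surjective f)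
    {h : A} (h0 : h ≠ 0) (hfh : f h = 0) (fin : Algebra.trdeg k A < Cardinal.aleph0) :
    Algebra.trdeg k B < Algebra.trdeg k A := by
  by_contra! hle
  obtain ⟨s, hs⟩ := exists_isTranscendenceBasis k B
  choose g hg using hf
  set x : s → A := fun i => g i with hx
  have hfx : f ∘ x = ((↑) : s → B) := by
    ext i; simp [hx, hg]
  have hxi : AlgebraicIndependent k x := by
    apply AlgebraicIndependent.of_comp f
    rw [hfx]; exact hs.1
  have hxb : IsTranscendenceBasis k x := by
    refine hxi.isTranscendenceBasis_of_trdeg_le fin ?_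
    rw [hs.cardinalMk_eq_trdeg]; exact hle
  have := hxb.isAlgebraic
  obtain ⟨r, hr, hdvd⟩ := (this.1 h).exists_nonzero_dvd (mem_nonZeroDivisors_of_ne_zero h0)
  apply hr
  obtain ⟨r, hr'⟩ := r
  obtain ⟨p, rfl⟩ := (Algebra.adjoin_range_eq_range_aeval k x ▸ hr' : r ∈ (aeval x).range)
  have h1 : f (aeval x p) = 0 := by
    obtain ⟨c, hc⟩ := hdvd
    change (aeval x) p = h * c at hc
    rw [hc, map_mul, hfh, zero_mul]
  have h2 : aeval ((↑) : s → B) p = 0 := by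
    rw [← hfx]
    rw [← h1, MvPolynomial.comp_aeval_apply]; rfl
  have := hs.1
  rw [algebraicIndependent_iff] at this
  have hp := this p h2
  subst hp
  ext; simp

/-- The affine coordinate ring of a set of points. -/
abbrev CR (E : Set (σ → k)) : Type := MvPolynomial σ k ⧸ vanishingIdeal k E

/-- The dimension of (the closure of) a set of points of affine space. -/
def td (E : Set (σ → k)) : Cardinal := Algebra.trdeg k (CR E)

/-- The Zariski closure of the set is irreducible. -/
def Irr (E : Set (σ → k)) : Prop := (vanishingIdeal k E).IsPrime

theorem mem_vI {E : Set (σ → k)} {p : MvPolynomial σ k} :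
    p ∈ vanishingIdeal k E ↔ ∀ x ∈ E, eval x p = 0 := by
  simp [mem_vanishingIdeal_iff, aeval_eq_eval]

theorem mk_eq_zero_iff {E : Set (σ → k)} {p : MvPolynomial σ k} :
    (Ideal.Quotient.mkₐ k (vanishingIdeal k E)) p = 0 ↔ ∀ x ∈ E, eval x p = 0 := by
  rw [← mem_vI]; exact Ideal.Quotient.eq_zero_iff_mem

theorem Irr.isDomain {E : Set (σ → k)} (h : Irr E) : IsDomain (CR E) := by
  have : (vanishingIdeal k E).IsPrime := h
  infer_instance

theorem Irr.nonempty {E : Set (σ → k)} (h : Irr E) : E.Nonempty := by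
  by_contra hE
  rw [Set.not_nonempty_iff_eq_empty] at hE
  subst hE
  exact h.ne_top vanishingIdeal_empty

theorem Irr.mem_or {E : Set (σ → k)} (h : Irr E) {f g : MvPolynomial σ k}
    (hfg : ∀ x ∈ E, eval x (f * g) = 0) : (∀ x ∈ E, eval x f = 0) ∨ ∀ x ∈ E, eval x g = 0 := by
  rw [← mem_vI, ← mem_vI]; exact Ideal.IsPrime.mem_or_mem h (mem_vI.2 hfg)

theorem irr_of {E : Set (σ → k)} (hE : E.Nonempty)
    (h : ∀ f g : MvPolynomial σ k, (∀ x ∈ E, eval x f * eval x g = 0) →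
      (∀ x ∈ E, eval x f = 0) ∨ ∀ x ∈ E, eval x g = 0) : Irr E := by
  constructor
  · obtain ⟨x, hx⟩ := hE
    intro h1
    have : (1 : MvPolynomial σ k) ∈ vanishingIdeal k E := by rw [h1]; trivial
    simpa using mem_vI.1 this x hx
  · intro f g hfg
    rw [mem_vI, mem_vI]
    exact h f g (fun x hx => by simpa using mem_vI.1 hfg x hx)

theorem td_lt_aleph0 [Finite σ] (E : Set (σ → k)) : td E < Cardinal.aleph0 := by
  exact trdeg_lt_aleph0_of_finiteType

theorem td_mono {E F : Set (σ → k)} (h : ∀ p : MvPolynomial σ k, (∀ x ∈ F, eval x p = 0) →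
    ∀ x ∈ E, eval x p = 0) : td E ≤ td F := by
  have hle : vanishingIdeal k F ≤ vanishingIdeal k E := by
    intro p hp
    rw [mem_vI] at hp ⊢; exact h p hp
  exact trdeg_le_of_surjective (Ideal.Quotient.factorₐ k hle)
    (Ideal.Quotient.factor_surjective hle)

theorem td_lt [Finite σ] {E F : Set (σ → k)} (hE : Irr E) (hF : Irr F)
    (h : ∀ p : MvPolynomial σ k, (∀ x ∈ F, eval x p = 0) → ∀ x ∈ E, eval x p = 0)
    {p : MvPolynomial σ k} (hp : ∀ x ∈ E, eval x p = 0) {y : σ → k} (hy : y ∈ F)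
    (hpy : eval y p ≠ 0) : td E < td F := by
  have hle : vanishingIdeal k F ≤ vanishingIdeal k E := by
    intro p hp
    rw [mem_vI] at hp ⊢; exact h p hp
  have := hE.isDomain
  have := hF.isDomain
  refine trdeg_lt_of_surjective (Ideal.Quotient.factorₐ k hle)
    (Ideal.Quotient.factor_surjective hle) (h := Ideal.Quotient.mkₐ k _ p) ?_ ?_ (td_lt_aleph0 F)
  · rw [Ne, mk_eq_zero_iff]; intro h; exact hpy (h y hy)
  · exact mk_eq_zero_iff.2 hp

/-- Evaluation of a tuple of polynomials. -/
abbrev pmap (φ : τ → MvPolynomial σ k) (x : σ → k) : τ → k := fun j => eval x (φ j)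

theorem eval_bind (φ : τ → MvPolynomial σ k) (x : σ → k) (p : MvPolynomial τ k) :
    eval x (aeval φ p) = eval (pmap φ x) p := by
  induction p using MvPolynomial.induction_on <;> simp_all [pmap]

theorem td_image_le {E : Set (σ → k)} {F : Set (τ → k)} (φ : τ → MvPolynomial σ k)
    (h1 : ∀ p : MvPolynomial τ k, (∀ x ∈ F, eval x p = 0) ↔ ∀ x ∈ E, eval (pmap φ x) p = 0) :
    td F ≤ td E := by
  have hf : ∀ p ∈ vanishingIdeal k F,
      ((Ideal.Quotient.mkₐ k (vanishingIdeal k E)).comp (aeval φ)) p = 0 := by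
    intro p hp
    rw [AlgHom.comp_apply, mk_eq_zero_iff]
    intro x hx
    rw [eval_bind]
    exact (h1 p).1 (mem_vI.1 hp) x hx
  refine trdeg_le_of_injective (Ideal.Quotient.liftₐ _ _ hf) ?_
  rw [injective_iff_map_eq_zero]
  intro a ha
  obtain ⟨p, rfl⟩ := Ideal.Quotient.mk_surjective a
  erw [Ideal.Quotient.liftₐ_apply, Ideal.Quotient.lift_mk] at ha
  change ((Ideal.Quotient.mkₐ k (vanishingIdeal k E)).comp (aeval φ)) p = 0 at ha
  rw [AlgHom.comp_apply, mk_eq_zero_iff] at ha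
  rw [Ideal.Quotient.eq_zero_iff_mem, mem_vI, h1]
  intro x hx
  rw [← eval_bind]; exact ha x hx

theorem irr_image {E : Set (σ → k)} (hE : Irr E) {F : Set (τ → k)} (φ : τ → MvPolynomial σ k)
    (h1 : ∀ p : MvPolynomial τ k, (∀ x ∈ F, eval x p = 0) ↔ ∀ x ∈ E, eval (pmap φ x) p = 0) :
    Irr F := by
  apply irr_of
  · by_contra hF
    rw [Set.not_nonempty_iff_eq_empty] at hF
    subst hF
    obtain ⟨x, hx⟩ := hE.nonempty
    have := (h1 1).1 (by simp) x hx
    simp at this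
  · intro f g hfg
    rw [h1, h1]
    have := (h1 (f * g)).1 (by simpa using hfg)
    simp only [← eval_bind] at this ⊢
    apply hE.mem_or
    simpa using this

end Affine

section Products

variable {k : Type} [Field k]

theorem trdeg_eq_add_of_slices {A B C : Type} [CommRing A] [CommRing B] [CommRing C]
    [IsDomain A] [IsDomain B] [IsDomain C] [Algebra k A] [Algebra k B] [Algebra k C]
    (iA : A →ₐ[k] C) (iB : B →ₐ[k] C) {ι : Type} (e : ι → A →ₐ[k] k) (s : ι → C →ₐ[k] B)
    (hsB : ∀ x b, s x (iB b) = b) (hsA : ∀ x a, s x (iA a) = algebraMap k B (e x a))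
    (he : ∀ a, (∀ x, e x a = 0) → a = 0)
    (hgen : Algebra.adjoin k (Set.range iA ∪ Set.range iB) = ⊤) :
    Algebra.trdeg k C = Algebra.trdeg k A + Algebra.trdeg k B := by
  have hiA : Function.Injective iA := by
    rw [injective_iff_map_eq_zero]
    intro a ha
    refine he a fun x => ?_
    have := hsA x a
    rw [ha, map_zero] at this
    exact (FaithfulSMul.algebraMap_eq_zero_iff k B).1 this.symm
  let _ : Algebra A C := iA.toRingHom.toAlgebra
  have hAC : ∀ a, algebraMap A C a = iA a := fun _ => rfl
  have : IsScalarTower k A C := IsScalarTower.of_algebraMap_eq (fun r => by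
    rw [hAC, AlgHom.commutes])
  have : FaithfulSMul A C := (faithfulSMul_iff_algebraMap_injective A C).2 hiA
  obtain ⟨t, ht⟩ := exists_isTranscendenceBasis k B
  have hind : AlgebraicIndependent A (fun b : t => iB b) := by
    rw [algebraicIndependent_iff]
    intro p hp
    ext m
    refine he _ fun x => ?_
    have h1 : aeval (fun b : t => (b : B)) (MvPolynomial.map (e x).toRingHom p) = 0 := by
      have h2 := congrArg (s x) hp
      rw [map_zero] at h2
      rw [← h2]
      clear h2 hp
      induction p using MvPolynomial.induction_on with
      | C a => simpa [hAC] using (hsA x a).symm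
      | add p q hp hq => simp only [map_add, hp, hq]
      | mul_X p i hp => simp only [map_mul, hp, map_X, aeval_X, hsB]
    have h3 := (algebraicIndependent_iff.1 ht.1) _ h1
    have := congrArg (coeff m) h3
    simpa [coeff_map] using this
  have hbas : IsTranscendenceBasis A (fun b : t => iB b) := by
    rw [hind.isTranscendenceBasis_iff_isAlgebraic]
    set R := Algebra.adjoin A (Set.range fun b : t => iB b) with hR
    have hB : ∀ b : B, IsAlgebraic R (iB b) := by
      intro b
      have hb := ht.isAlgebraic.1 b
      have hmem : ∀ y : Algebra.adjoin k (Set.range ((↑) : t → B)), iB (y : B) ∈ R := by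
        rintro ⟨y, hy⟩
        induction hy using Algebra.adjoin_induction with
        | mem x hx =>
          obtain ⟨i, rfl⟩ := hx
          exact Algebra.subset_adjoin ⟨i, rfl⟩
        | algebraMap r =>
          simp only [AlgHom.commutes]
          rw [IsScalarTower.algebraMap_apply k A C]
          exact R.algebraMap_mem _
        | add x y hx hy h1 h2 => simpa using add_mem h1 h2
        | mul x y hx hy h1 h2 => simpa using mul_mem h1 h2
      let g : Algebra.adjoin k (Set.range ((↑) : t → B)) →+* R :=
        (iB.toRingHom.comp (Subalgebra.val _).toRingHom).codRestrict R hmem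
      refine hb.ringHom_of_comp_eq g iB.toRingHom ?_ ?_
      · intro y z hyz
        have h1 : iB (y : B) = iB (z : B) := congrArg Subtype.val hyz
        apply Subtype.ext
        by_cases hι : Nonempty ι
        · obtain ⟨x⟩ := hι
          rw [← hsB x y, h1, hsB]
        · exact absurd (he 1 (fun x => (hι ⟨x⟩).elim)) one_ne_zero
      · ext y; rfl
    constructor
    intro c
    have hc : c ∈ Algebra.adjoin k (Set.range iA ∪ Set.range iB) := by rw [hgen]; trivial
    induction hc using Algebra.adjoin_induction with
    | mem x hx =>
      rcases hx with ⟨a, rfl⟩ | ⟨b, rfl⟩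
      · have : iA a = algebraMap R C (algebraMap A R a) := rfl
        rw [this]; exact isAlgebraic_algebraMap _
      · exact hB b
    | algebraMap r =>
      have : algebraMap k C r = algebraMap R C (algebraMap A R (algebraMap k A r)) := by
        change _ = iA _
        simp
      rw [this]; exact isAlgebraic_algebraMap _
    | add x y hx hy h1 h2 => exact h1.add h2
    | mul x y hx hy h1 h2 => exact h1.mul h2
  have : FaithfulSMul k A := inferInstance
  rw [← trdeg_add_eq k A, ← hbas.cardinalMk_eq_trdeg, ← ht.cardinalMk_eq_trdeg]

variable {σ τ : Type}

/-- The product of two sets of points. -/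
def prodSet (E : Set (σ → k)) (F : Set (τ → k)) : Set (σ ⊕ τ → k) :=
  {v | v ∘ Sum.inl ∈ E ∧ v ∘ Sum.inr ∈ F}

theorem elim_mem_prodSet {E : Set (σ → k)} {F : Set (τ → k)} {x : σ → k} {y : τ → k}
    (hx : x ∈ E) (hy : y ∈ F) : Sum.elim x y ∈ prodSet E F := ⟨hx, hy⟩

theorem forall_prodSet {E : Set (σ → k)} {F : Set (τ → k)} {P : (σ ⊕ τ → k) → Prop} :
    (∀ v ∈ prodSet E F, P v) ↔ ∀ x ∈ E, ∀ y ∈ F, P (Sum.elim x y) := by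
  constructor
  · intro h x hx y hy; exact h _ (elim_mem_prodSet hx hy)
  · rintro h v ⟨h1, h2⟩
    simpa using h _ h1 _ h2

/-- Substituting the first group of variables. -/
def sliceL (x : σ → k) : MvPolynomial (σ ⊕ τ) k →ₐ[k] MvPolynomial τ k :=
  aeval (Sum.elim (fun i => C (x i)) X)

/-- Substituting the second group of variables. -/
def sliceR (y : τ → k) : MvPolynomial (σ ⊕ τ) k →ₐ[k] MvPolynomial σ k :=
  aeval (Sum.elim X (fun i => C (y i)))

theorem eval_sliceL (x : σ → k) (y : τ → k) (p : MvPolynomial (σ ⊕ τ) k) :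
    eval y (sliceL x p) = eval (Sum.elim x y) p := by
  rw [sliceL, eval_bind]
  congr 2
  ext (i | i) <;> simp [pmap]

theorem eval_sliceR (x : σ → k) (y : τ → k) (p : MvPolynomial (σ ⊕ τ) k) :
    eval x (sliceR y p) = eval (Sum.elim x y) p := by
  rw [sliceR, eval_bind]
  congr 2
  ext (i | i) <;> simp [pmap]

theorem irr_prodSet {E : Set (σ → k)} {F : Set (τ → k)} (hE : Irr E) (hF : Irr F) :
    Irr (prodSet E F) := by
  obtain ⟨x0, hx0⟩ := hE.nonempty
  obtain ⟨y0, hy0⟩ := hF.nonempty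
  apply irr_of ⟨_, elim_mem_prodSet hx0 hy0⟩
  intro f g hfg
  rw [forall_prodSet] at hfg
  by_contra! hcon
  obtain ⟨⟨v, hv, hfv⟩, ⟨w, hw, hgw⟩⟩ := hcon
  have key : ∀ x ∈ E, (∀ y ∈ F, eval (Sum.elim x y) f = 0) ∨ ∀ y ∈ F,
      eval (Sum.elim x y) g = 0 := by
    intro x hx
    have := hF.mem_or (f := sliceL x f) (g := sliceL x g) (fun y hy => by
      rw [map_mul, eval_sliceL, eval_sliceL]; exact hfg x hx y hy)
    simpa only [eval_sliceL] using this
  have h2 := hE.mem_or (f := sliceR (v ∘ Sum.inr) f) (g := sliceR (w ∘ Sum.inr) g) (fun x hx => by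
    rw [map_mul, eval_sliceR, eval_sliceR]
    rcases key x hx with h | h
    · rw [h _ hv.2, zero_mul]
    · rw [h _ hw.2, mul_zero])
  rcases h2 with h | h
  · apply hfv
    have := h _ hv.1
    rw [eval_sliceR] at this
    simpa using this
  · apply hgw
    have := h _ hw.1
    rw [eval_sliceR] at this
    simpa using this

/-- Pull-back of functions along a polynomial map. -/
def crMap {E : Set (σ → k)} {F : Set (τ → k)} (φ : τ → MvPolynomial σ k)
    (h : ∀ x ∈ E, ∀ p : MvPolynomial τ k, (∀ y ∈ F, eval y p = 0) → eval (pmap φ x) p = 0) :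
    CR F →ₐ[k] CR E :=
  Ideal.Quotient.liftₐ _ ((Ideal.Quotient.mkₐ k (vanishingIdeal k E)).comp (aeval φ)) (by
    intro p hp
    rw [AlgHom.comp_apply, mk_eq_zero_iff]
    intro x hx
    rw [eval_bind]
    exact h x hx p (mem_vI.1 hp))

theorem crMap_mk {E : Set (σ → k)} {F : Set (τ → k)} (φ : τ → MvPolynomial σ k) (h)
    (p : MvPolynomial τ k) : crMap (E := E) (F := F) φ h (Ideal.Quotient.mkₐ k _ p) =
      Ideal.Quotient.mkₐ k _ (aeval φ p) := rfl

/-- Evaluation at a point. -/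
def crEval {E : Set (σ → k)} (x : E) : CR E →ₐ[k] k :=
  Ideal.Quotient.liftₐ _ (aeval (x : σ → k)) (by
    intro p hp
    rw [aeval_eq_eval]
    exact mem_vI.1 hp x x.2)

theorem crEval_mk {E : Set (σ → k)} (x : E) (p : MvPolynomial σ k) :
    crEval x (Ideal.Quotient.mkₐ k _ p) = eval (x : σ → k) p := by
  rw [← aeval_eq_eval]; rfl

theorem td_prodSet {E : Set (σ → k)} {F : Set (τ → k)} (hE : Irr E) (hF : Irr F) :
    td (prodSet E F) = td E + td F := by
  have := hE.isDomain
  have := hF.isDomain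
  have := (irr_prodSet hE hF).isDomain
  refine trdeg_eq_add_of_slices (ι := E)
    (crMap (E := prodSet E F) (F := E) (fun i => X (Sum.inl i)) ?_)
    (crMap (E := prodSet E F) (F := F) (fun i => X (Sum.inr i)) ?_)
    crEval
    (fun x => crMap (E := F) (F := prodSet E F) (Sum.elim (fun i => C (x.1 i)) X) ?_)
    ?_ ?_ ?_ ?_
  · rintro v ⟨hv, -⟩ p hp
    have := hp _ hv
    convert this using 3
    ext; simp [pmap]
  · rintro v ⟨-, hv⟩ p hp
    have := hp _ hv
    convert this using 3
    ext; simp [pmap]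
  · intro y hy p hp
    have := hp _ (elim_mem_prodSet x.2 hy)
    convert this using 3
    ext (i | i) <;> simp [pmap]
  · intro x b
    obtain ⟨p, rfl⟩ := Ideal.Quotient.mkₐ_surjective k _ b
    rw [crMap_mk, crMap_mk]
    congr 1
    rw [MvPolynomial.comp_aeval_apply]
    simp
  · intro x a
    obtain ⟨p, rfl⟩ := Ideal.Quotient.mkₐ_surjective k _ a
    rw [crMap_mk, crMap_mk, crEval_mk, ← AlgHom.commutes (Ideal.Quotient.mkₐ k (vanishingIdeal k
        F))]
    congr 1
    rw [MvPolynomial.comp_aeval_apply]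
    simp only [aeval_X, Sum.elim_inl, algebraMap_eq]
    rw [← aeval_eq_eval]
    induction p using MvPolynomial.induction_on <;> simp_all
  · intro a ha
    obtain ⟨p, rfl⟩ := Ideal.Quotient.mkₐ_surjective k _ a
    rw [mk_eq_zero_iff]
    intro x hx
    rw [← ha ⟨x, hx⟩, crEval_mk]
  · rw [eq_top_iff]
    rintro c -
    obtain ⟨p, rfl⟩ := Ideal.Quotient.mkₐ_surjective k _ c
    induction p using MvPolynomial.induction_on with
    | C a =>
      rw [← algebraMap_eq, AlgHom.commutes]
      exact Subalgebra.algebraMap_mem _ _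
    | add p q hp hq => rw [map_add]; exact add_mem hp hq
    | mul_X p i hp =>
      rw [map_mul]
      refine mul_mem hp (Algebra.subset_adjoin ?_)
      rcases i with i | i
      · left
        refine ⟨Ideal.Quotient.mkₐ k _ (X i), ?_⟩
        rw [crMap_mk, aeval_X]
      · right
        refine ⟨Ideal.Quotient.mkₐ k _ (X i), ?_⟩
        rw [crMap_mk, aeval_X]

end Products

section Linear

variable {k : Type} [Field k] {σ τ : Type} [Finite σ] [Finite τ]

/-- The dimension of a set of points of affine space, as a natural number. -/
def dm (E : Set (σ → k)) : ℕ := (td E).toNat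

theorem dm_cast (E : Set (σ → k)) : (dm E : Cardinal) = td E :=
  Cardinal.cast_toNat_of_lt_aleph0 (td_lt_aleph0 E)

theorem dm_mono {E F : Set (σ → k)} (h : ∀ p : MvPolynomial σ k, (∀ x ∈ F, eval x p = 0) →
    ∀ x ∈ E, eval x p = 0) : dm E ≤ dm F := by
  have := td_mono h
  rw [← dm_cast, ← dm_cast] at this
  exact_mod_cast this

theorem dm_congr {E F : Set (σ → k)} (h : ∀ p : MvPolynomial σ k, (∀ x ∈ F, eval x p = 0) ↔
    ∀ x ∈ E, eval x p = 0) : dm E = dm F :=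
  le_antisymm (dm_mono fun p => (h p).1) (dm_mono fun p => (h p).2)

theorem dm_lt {E F : Set (σ → k)} (hE : Irr E) (hF : Irr F)
    (h : ∀ p : MvPolynomial σ k, (∀ x ∈ F, eval x p = 0) → ∀ x ∈ E, eval x p = 0)
    {p : MvPolynomial σ k} (hp : ∀ x ∈ E, eval x p = 0) {y : σ → k} (hy : y ∈ F)
    (hpy : eval y p ≠ 0) : dm E < dm F := by
  have := td_lt hE hF h hp hy hpy
  rw [← dm_cast, ← dm_cast] at this
  exact_mod_cast this

/-- If a set contains another one in its closure and its dimension is not larger, then both have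
the same closure. -/
theorem eval_eq_zero_of_dm_le {E F : Set (σ → k)} (hE : Irr E) (hF : Irr F)
    (h : ∀ p : MvPolynomial σ k, (∀ x ∈ F, eval x p = 0) → ∀ x ∈ E, eval x p = 0)
    (hd : dm F ≤ dm E) {p : MvPolynomial σ k} (hp : ∀ x ∈ E, eval x p = 0) {y : σ → k}
    (hy : y ∈ F) : eval y p = 0 := by
  by_contra hpy
  exact absurd (dm_lt hE hF h hp hy hpy) (not_lt.2 hd)

theorem dm_prodSet {E : Set (σ → k)} {F : Set (τ → k)} (hE : Irr E) (hF : Irr F) :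
    dm (prodSet E F) = dm E + dm F := by
  have := td_prodSet hE hF
  rw [← dm_cast, ← dm_cast, ← dm_cast] at this
  exact_mod_cast this

theorem dm_image_le (φ : τ → MvPolynomial σ k) (E : Set (σ → k)) :
    dm (pmap φ '' E) ≤ dm E := by
  have := td_image_le (E := E) (F := pmap φ '' E) φ (by simp)
  rw [← dm_cast, ← dm_cast] at this
  exact_mod_cast this

theorem Irr.image {E : Set (σ → k)} (hE : Irr E) (φ : τ → MvPolynomial σ k) :
    Irr (pmap φ '' E) :=
  irr_image hE φ (by simp)

theorem vanishingIdeal_univ [Infinite k] : vanishingIdeal k (Set.univ : Set (σ → k)) = ⊥ := by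
  rw [eq_bot_iff]
  intro p hp
  rw [mem_vI] at hp
  exact MvPolynomial.funext (fun x => by simpa using hp x trivial)

theorem irr_univ [Infinite k] : Irr (Set.univ : Set (σ → k)) := by
  rw [Irr, vanishingIdeal_univ]
  exact Ideal.isPrime_bot

theorem dm_univ [Infinite k] : dm (Set.univ : Set (σ → k)) = Nat.card σ := by
  have h : td (Set.univ : Set (σ → k)) = Cardinal.mk σ := by
    have e := Ideal.quotientEquivAlgOfEq k (vanishingIdeal_univ (k := k) (σ := σ))
    rw [td, (e.trans (AlgEquiv.quotientBot k (MvPolynomial σ k))).trdeg_eq,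
      MvPolynomial.trdeg_of_isDomain]
    simp
  rw [dm, h]; rfl

/-- The linear forms of a linear map. -/
def linForms (f : (σ → k) →ₗ[k] (τ → k)) (j : τ) : MvPolynomial σ k :=
  letI := Fintype.ofFinite σ
  letI := Classical.decEq σ
  ∑ i, C (f (Pi.single i 1) j) * X i

theorem pmap_linForms (f : (σ → k) →ₗ[k] (τ → k)) (x : σ → k) : pmap (linForms f) x = f x := by
  ext j
  let := Fintype.ofFinite σ
  let := Classical.decEq σ
  have h : x = ∑ i, x i • Pi.single i (1 : k) := by
    ext i; simp [Pi.single_apply]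
  conv_rhs => rw [h, map_sum]
  simp [pmap, linForms, mul_comm]

theorem dm_map_le (f : (σ → k) →ₗ[k] (τ → k)) (E : Set (σ → k)) : dm (f '' E) ≤ dm E := by
  have := dm_image_le (linForms f) E
  rwa [show pmap (linForms f) = f from funext (pmap_linForms f)] at this

theorem Irr.map {E : Set (σ → k)} (hE : Irr E) (f : (σ → k) →ₗ[k] (τ → k)) : Irr (f '' E) := by
  have := hE.image (linForms f)
  rwa [show pmap (linForms f) = f from funext (pmap_linForms f)] at this

theorem irr_submodule_and_dm [Infinite k] (W : Submodule k (σ → k)) :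
    Irr (W : Set (σ → k)) ∧ dm (W : Set (σ → k)) = Module.finrank k W := by
  have e : (Fin (Module.finrank k W) → k) ≃ₗ[k] W := (Module.finBasis k W).equivFun.symm
  let f : (Fin (Module.finrank k W) → k) →ₗ[k] (σ → k) := W.subtype ∘ₗ e.toLinearMap
  have hf : f '' Set.univ = (W : Set (σ → k)) := by
    ext v
    constructor
    · rintro ⟨x, -, rfl⟩; exact (e x).2
    · intro hv; exact ⟨e.symm ⟨v, hv⟩, trivial, by simp [f]⟩
  have hinj : LinearMap.ker f = ⊥ := LinearMap.ker_eq_bot.2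
    (Subtype.val_injective.comp e.injective)
  obtain ⟨g, hg⟩ := LinearMap.exists_leftInverse_of_injective f hinj
  have hg' : g '' (W : Set (σ → k)) = Set.univ := by
    rw [← hf, Set.image_image]
    have : ∀ x, g (f x) = x := fun x => by rw [← LinearMap.comp_apply, hg]; rfl
    simp [this]
  refine ⟨hf ▸ irr_univ.map f, le_antisymm ?_ ?_⟩
  · have := dm_map_le f Set.univ
    rw [hf, dm_univ] at this
    simpa using this
  · have := dm_map_le g (W : Set (σ → k))
    rw [hg', dm_univ] at this
    simpa using this

end Linear

section Projective

variable {k : Type} [Field k] {n : ℕ}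

/-- The affine cone over a subset of projective space. -/
def cn (Z : Set (PS k n)) : Set (Fin n → k) := {v | ∀ hv : v ≠ 0, Projectivization.mk k v hv ∈ Z}

theorem zero_mem_cn (Z : Set (PS k n)) : (0 : Fin n → k) ∈ cn Z := fun h => (h rfl).elim

theorem mem_cn_iff {Z : Set (PS k n)} {v : Fin n → k} (hv : v ≠ 0) :
    v ∈ cn Z ↔ Projectivization.mk k v hv ∈ Z := ⟨fun h => h hv, fun h _ => h⟩

theorem mk_smul {c : k} {v : Fin n → k} (hv : v ≠ 0) (hcv : c • v ≠ 0) :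
    Projectivization.mk k (c • v) hcv = Projectivization.mk k v hv := by
  rw [Projectivization.mk_eq_mk_iff']
  exact ⟨c, rfl⟩

theorem smul_mem_cn {Z : Set (PS k n)} {v : Fin n → k} (h : v ∈ cn Z) (c : k) : c • v ∈ cn Z := by
  intro hcv
  have hv : v ≠ 0 := fun h => hcv (by rw [h, smul_zero])
  rw [mk_smul hv]
  exact h hv

theorem cn_mono {S T : Set (PS k n)} (h : S ⊆ T) : cn S ⊆ cn T := fun _ hv hv0 => h (hv hv0)

theorem subset_of_cn {S T : Set (PS k n)} (h : cn S ⊆ cn T) : S ⊆ T := by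
  intro p hp
  induction p using Projectivization.ind with
  | h v hv => exact (mem_cn_iff hv).1 (h ((mem_cn_iff hv).2 hp))

theorem eval_smul_of_isHomogeneous {f : MvPolynomial (Fin n) k} {d : ℕ} (hf : f.IsHomogeneous d)
    (c : k) (v : Fin n → k) : eval (c • v) f = c ^ d * eval v f := by
  rw [eval_eq', eval_eq', Finset.mul_sum]
  refine Finset.sum_congr rfl fun m hm => ?_
  have hd : ∑ i, m i = d := by
    have := hf (mem_support_iff.1 hm)
    rw [Finsupp.weight_apply, Finsupp.sum_fintype _ _ (by simp)] at this
    simpa using this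
  simp only [Pi.smul_apply, smul_eq_mul, mul_pow, Finset.prod_mul_distrib,
    Finset.prod_pow_eq_pow_sum, hd]
  ring

theorem mem_V0_iff {f : MvPolynomial (Fin n) k} {d : ℕ} (hf : f.IsHomogeneous d)
    {v : Fin n → k} (hv : v ≠ 0) : Projectivization.mk k v hv ∈ V0 f ↔ eval v f = 0 := by
  constructor
  · intro h; exact h v hv rfl
  · intro h w hw hwv
    rw [Projectivization.mk_eq_mk_iff'] at hwv
    obtain ⟨c, rfl⟩ := hwv
    rw [eval_smul_of_isHomogeneous hf, h, mul_zero]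

theorem isClosed_V0 {f : MvPolynomial (Fin n) k} {d : ℕ} (hf : f.IsHomogeneous d) :
    IsClosed (V0 f) := by
  rw [← isOpen_compl_iff]
  exact TopologicalSpace.isOpen_generateFrom_of_mem ⟨d, f, hf, rfl⟩

theorem exists_homog_of_isOpen {U : Set (PS k n)} (hU : IsOpen U) {v : Fin n → k} (hv : v ≠ 0)
    (hp : Projectivization.mk k v hv ∈ U) :
    ∃ (d : ℕ) (f : MvPolynomial (Fin n) k), f.IsHomogeneous d ∧ eval v f ≠ 0 ∧
      ∀ w (hw : w ≠ 0), eval w f ≠ 0 → Projectivization.mk k w hw ∈ U := by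
  induction hU with
  | basic s hs =>
    obtain ⟨d, f, hf, rfl⟩ := hs
    refine ⟨d, f, hf, ?_, ?_⟩
    · rwa [Set.mem_compl_iff, mem_V0_iff hf] at hp
    · intro w hw h
      rwa [Set.mem_compl_iff, mem_V0_iff hf]
  | univ => exact ⟨0, 1, isHomogeneous_one _ _, by simp, fun _ _ _ => trivial⟩
  | inter s t _ _ hs ht =>
    obtain ⟨d, f, hf, h1, h2⟩ := hs hp.1
    obtain ⟨e, g, hg, h3, h4⟩ := ht hp.2
    refine ⟨d + e, f * g, hf.mul hg, by simp [h1, h3], fun w hw h => ?_⟩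
    rw [map_mul] at h
    exact ⟨h2 w hw (left_ne_zero_of_mul h), h4 w hw (right_ne_zero_of_mul h)⟩
  | sUnion S _ ih =>
    obtain ⟨s, hs, hps⟩ := hp
    obtain ⟨d, f, hf, h1, h2⟩ := ih s hs hps
    exact ⟨d, f, hf, h1, fun w hw h => ⟨s, hs, h2 w hw h⟩⟩

theorem exists_homog_of_notMem_closure {S : Set (PS k n)} {v : Fin n → k} (hv : v ≠ 0)
    (hp : Projectivization.mk k v hv ∉ closure S) :
    ∃ (d : ℕ) (f : MvPolynomial (Fin n) k), f.IsHomogeneous d ∧ eval v f ≠ 0 ∧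
      ∀ w ∈ cn S, w ≠ 0 → eval w f = 0 := by
  obtain ⟨d, f, hf, h1, h2⟩ := exists_homog_of_isOpen isClosed_closure.isOpen_compl hv hp
  refine ⟨d, f, hf, h1, fun w hw hw0 => ?_⟩
  by_contra h
  exact h2 w hw0 h (subset_closure (hw hw0))

theorem eval_homogeneousComponent [Infinite k] {E : Set (Fin n →
    k)} (hE : ∀ v ∈ E, ∀ c : k, c • v ∈ E)
    {f : MvPolynomial (Fin n) k} (hf : ∀ v ∈ E, eval v f = 0) (d : ℕ) :
    ∀ v ∈ E, eval v (homogeneousComponent d f) = 0 := by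
  intro v hv
  let P : Polynomial k := ∑ i ∈ Finset.range (f.totalDegree + 1),
    Polynomial.monomial i (eval v (homogeneousComponent i f))
  have hP : P = 0 := by
    apply Polynomial.funext
    intro c
    have := hf _ (hE v hv c)
    rw [← sum_homogeneousComponent f, map_sum] at this
    simp only [eval_smul_of_isHomogeneous (homogeneousComponent_isHomogeneous _ f)] at this
    simp only [P, Polynomial.eval_finsetSum, Polynomial.eval_monomial, Polynomial.eval_zero]
    rw [← this]
    exact Finset.sum_congr rfl fun _ _ => mul_comm _ _
  by_cases hd : d < f.totalDegree + 1
  · have := congrArg (Polynomial.coeff · d) hP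
    simpa [P, Polynomial.finsetSum_coeff, Polynomial.coeff_monomial, hd, Nat.lt_succ_iff] using this
  · rw [homogeneousComponent_eq_zero _ _ (by omega), map_zero]

end Projective

section Projective

variable {k : Type} [Field k] {n : ℕ}

theorem eval_eq_zero_of_components {f : MvPolynomial (Fin n) k} {v : Fin n → k}
    (h : ∀ d, eval v (homogeneousComponent d f) = 0) : eval v f = 0 := by
  rw [← sum_homogeneousComponent f, map_sum]
  exact Finset.sum_eq_zero fun d _ => h d

theorem vanish_cn_closure [Infinite k] {S : Set (PS k n)} {f : MvPolynomial (Fin n) k}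
    (hf : ∀ v ∈ cn S, eval v f = 0) : ∀ v ∈ cn (closure S), eval v f = 0 := by
  intro v hv
  by_cases hv0 : v = 0
  · subst hv0; exact hf _ (zero_mem_cn S)
  refine eval_eq_zero_of_components fun d => ?_
  have hS : S ⊆ V0 (homogeneousComponent d f) := by
    intro p hp
    induction p using Projectivization.ind with
    | h w hw =>
      rw [mem_V0_iff (homogeneousComponent_isHomogeneous d f)]
      exact eval_homogeneousComponent (fun v hv c => smul_mem_cn hv c) hf d w
        ((mem_cn_iff hw).2 hp)
  have := closure_minimal hS (isClosed_V0 (homogeneousComponent_isHomogeneous d f)) (hv hv0)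
  rwa [mem_V0_iff (homogeneousComponent_isHomogeneous d f)] at this

theorem dm_cn_closure [Infinite k] (S : Set (PS k n)) : dm (cn (closure S)) = dm (cn S) :=
  dm_congr fun _ => ⟨vanish_cn_closure, fun h v hv => h v (cn_mono subset_closure hv)⟩

theorem dm_cn_mono {S T : Set (PS k n)} (h : S ⊆ T) : dm (cn S) ≤ dm (cn T) :=
  dm_mono fun _ hp x hx => hp x (cn_mono h hx)

theorem mem_cn_of_forall {Z : Set (PS k n)} (hZ : IsClosed Z) {v : Fin n → k}
    (h : ∀ p : MvPolynomial (Fin n) k, (∀ x ∈ cn Z, eval x p = 0) → eval v p = 0) : v ∈ cn Z := by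
  intro hv
  by_contra hcon
  rw [← hZ.closure_eq] at hcon
  obtain ⟨d, f, hf, h1, h2⟩ := exists_homog_of_notMem_closure hv hcon
  rcases Nat.eq_zero_or_pos d with rfl | hd
  · have hc : ∀ w ∈ cn Z, w = 0 := by
      intro w hw
      by_contra hw0
      apply h1
      have := h2 w hw hw0
      rw [(totalDegree_eq_zero_iff_eq_C.1 (Nat.le_zero.1 hf.totalDegree_le))] at this ⊢
      simpa using this
    apply hv
    ext i
    have := h (X i) (fun x hx => by rw [hc x hx]; simp)
    simpa using this
  · refine h1 (h f fun x hx => ?_)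
    by_cases hx0 : x = 0
    · subst hx0
      have := eval_smul_of_isHomogeneous hf 0 (0 : Fin n → k)
      rwa [zero_pow hd.ne', zero_mul, smul_zero] at this
    · exact h2 x hx hx0

theorem irr_cn [Infinite k] {Z : Set (PS k n)} (hZ : IsIrreducible Z) : Irr (cn Z) := by
  let _ : GradedAlgebra (homogeneousSubmodule (Fin n) k) := MvPolynomial.gradedAlgebra
  have hh : (vanishingIdeal k (cn Z)).IsHomogeneous (homogeneousSubmodule (Fin n) k) := by
    intro d f hf
    rw [mem_vI] at hf ⊢
    have := eval_homogeneousComponent (fun v hv c => smul_mem_cn hv c) hf d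
    rwa [← decomposition.decompose'_apply] at this
  refine hh.isPrime_of_homogeneous_mem_or_mem ?_ ?_
  · intro h1
    have : (1 : MvPolynomial (Fin n) k) ∈ vanishingIdeal k (cn Z) := by rw [h1]; trivial
    simpa using mem_vI.1 this 0 (zero_mem_cn Z)
  · rintro f g ⟨d, hf⟩ ⟨e, hg⟩ hfg
    rw [mem_homogeneousSubmodule] at hf hg
    rw [mem_vI] at hfg
    rw [mem_vI, mem_vI]
    have hsub : Z ⊆ V0 f ∪ V0 g := by
      intro p hp
      induction p using Projectivization.ind with
      | h w hw =>
        have := hfg w ((mem_cn_iff hw).2 hp)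
        rw [map_mul, mul_eq_zero] at this
        exact this.imp (mem_V0_iff hf hw).2 (mem_V0_iff hg hw).2
    have aux : ∀ (d : ℕ) (f : MvPolynomial (Fin n) k), f.IsHomogeneous d → Z ⊆ V0 f →
        ∀ x ∈ cn Z, eval x f = 0 := by
      intro d f hf hZf x hx
      obtain ⟨p, hp⟩ := hZ.nonempty
      induction p using Projectivization.ind with
      | h w hw =>
        have h2 := (mem_V0_iff hf hw).1 (hZf hp)
        by_cases hx0 : x = 0
        · have := eval_smul_of_isHomogeneous hf 0 w
          rw [h2, mul_zero, zero_smul] at this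
          rwa [hx0]
        · exact (mem_V0_iff hf hx0).1 (hZf (hx hx0))
    have := isPreirreducible_iff_isClosed_union_isClosed.1 hZ.isPreirreducible _ _
      (isClosed_V0 hf) (isClosed_V0 hg) hsub
    exact this.imp (aux d f hf) (aux e g hg)

theorem dm_cn_lt [Infinite k] {Z W : Set (PS k n)} (hZc : IsClosed Z) (hZ : IsIrreducible Z)
    (hW : IsIrreducible W) (h : Z ⊂ W) : dm (cn Z) < dm (cn W) := by
  obtain ⟨hs, hne⟩ := Set.ssubset_iff_exists.1 h
  obtain ⟨p, hpW, hpZ⟩ := hne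
  induction p using Projectivization.ind with
  | h v hv =>
    have h1 : ¬ ∀ p : MvPolynomial (Fin n) k, (∀ x ∈ cn Z, eval x p = 0) → eval v p = 0 :=
      fun h => hpZ (mem_cn_of_forall hZc h hv)
    push Not at h1
    obtain ⟨p, hp, hpv⟩ := h1
    exact dm_lt (irr_cn hZ) (irr_cn hW) (fun q hq x hx => hq x (cn_mono hs hx)) hp
      ((mem_cn_iff hv).2 hpW) hpv

instance : TopologicalSpace.NoetherianSpace (PS k n) := by
  rw [((TopologicalSpace.noetherianSpace_TFAE (PS k n)).out 0 1 :)]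
  let g : TopologicalSpace.Closeds (PS k n) → (Ideal (MvPolynomial (Fin n) k))ᵒᵈ :=
    fun Z => OrderDual.toDual (vanishingIdeal k (cn (Z : Set (PS k n))))
  have hg : StrictMono g := by
    intro Z W h
    change vanishingIdeal k (cn (W : Set (PS k n))) < vanishingIdeal k (cn (Z : Set (PS k n)))
    refine lt_of_le_not_ge ?_ ?_
    · intro p hp
      rw [mem_vI] at hp ⊢
      exact fun x hx => hp x (cn_mono h.le hx)
    · intro hWZ
      apply h.not_ge
      apply subset_of_cn
      intro v hv
      refine mem_cn_of_forall Z.isClosed fun p hp => ?_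
      exact mem_vI.1 (hWZ (mem_vI.2 hp)) v hv
  exact hg.wellFoundedLT

theorem cn_linSet (W : Submodule k (Fin n → k)) : cn (linSet W) = (W : Set (Fin n → k)) := by
  ext v
  by_cases hv : v = 0
  · subst hv; simp [zero_mem_cn]
  · rw [mem_cn_iff hv]
    simp [linSet, Projectivization.submodule_mk]

theorem singleton_eq_linSet (p : PS k n) : {p} = linSet p.submodule := by
  apply Set.eq_of_subset_of_subset
  · rintro q rfl; exact le_refl q.submodule
  · intro q hq
    change q.submodule ≤ p.submodule at hq
    refine Projectivization.submodule_injective ?_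
    exact Submodule.eq_of_le_of_finrank_eq hq (by rw [q.finrank_submodule, p.finrank_submodule])

theorem isHomogeneous_linForms {σ τ : Type} [Finite σ] [Finite τ] (f : (σ → k) →ₗ[k] (τ → k))
    (j : τ) : (linForms f j).IsHomogeneous 1 :=
  IsHomogeneous.sum _ _ _ fun _ _ => isHomogeneous_C_mul_X _ _

theorem isClosed_linSet (W : Submodule k (Fin n → k)) : IsClosed (linSet W) := by
  have : linSet W = ⋂ f : {f : (Fin n → k) →ₗ[k] (Fin 1 → k) // ∀ w ∈ W, f w = 0},
      V0 (linForms f.1 0) := by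
    have key : ∀ (f : (Fin n → k) →ₗ[k] (Fin 1 → k)) v, eval v (linForms f 0) = f v 0 :=
      fun f v => congrFun (pmap_linForms f v) 0
    ext p
    induction p using Projectivization.ind with
    | h v hv =>
      rw [← mem_cn_iff hv, cn_linSet, Set.mem_iInter]
      simp_rw [mem_V0_iff (isHomogeneous_linForms _ _) hv, key]
      constructor
      · intro h f; rw [f.2 v h]; rfl
      · intro h
        by_contra hvW
        obtain ⟨g, hg, hWg⟩ := Submodule.exists_le_ker_of_notMem hvW
        refine hg (h ⟨LinearMap.pi fun _ => g, fun w hw => ?_⟩)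
        ext; exact hWg hw
  rw [this]
  exact isClosed_iInter fun f => isClosed_V0 (isHomogeneous_linForms _ _)

theorem isClosed_point (p : PS k n) : IsClosed ({p} : Set (PS k n)) := by
  rw [singleton_eq_linSet]; exact isClosed_linSet _

theorem dm_cn_linSet [Infinite k] (W : Submodule k (Fin n → k)) :
    dm (cn (linSet W)) = Module.finrank k W := by
  rw [cn_linSet]; exact (irr_submodule_and_dm W).2

theorem dm_cn_singleton [Infinite k] (p : PS k n) : dm (cn {p}) = 1 := by
  rw [singleton_eq_linSet, dm_cn_linSet, p.finrank_submodule]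

theorem eq_singleton_of_dm_le [Infinite k] {Z : Set (PS k n)} (hZ : IsIrreducible Z)
    (h : dm (cn Z) ≤ 1) : ∃ p, Z = {p} := by
  obtain ⟨p, hp⟩ := hZ.nonempty
  refine ⟨p, ?_⟩
  by_contra hne
  have := dm_cn_lt (isClosed_point p) isIrreducible_singleton hZ
    (LE.le.ssubset_of_ne (by simpa using hp) (Ne.symm hne))
  rw [dm_cn_singleton] at this
  omega

theorem finite_of_ssubset_curve [Infinite k] {Z W : Set (PS k n)} (hZ : IsIrreducible Z)
    (h : dm (cn Z) ≤ 2) (hWc : IsClosed W) (hW : W ⊂ Z) : W.Finite := by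
  obtain ⟨T, hT, hTc, hTi, hTU⟩ :=
    TopologicalSpace.NoetherianSpace.exists_finite_set_isClosed_irreducible hWc
  rw [hTU]
  refine hT.sUnion fun t ht => ?_
  have hts : t ⊆ W := hTU ▸ Set.subset_sUnion_of_mem ht
  have := dm_cn_lt (hTc t ht) (hTi t ht) hZ (hts.trans_ssubset hW)
  obtain ⟨p, rfl⟩ := eq_singleton_of_dm_le (hTi t ht) (by omega)
  exact Set.finite_singleton p

theorem pdim_le [Infinite k] {S : Set (PS k n)} {m : ℕ}
    (h : ∀ Z ⊆ S, IsIrreducible Z → dm (cn Z) ≤ m + 1) : pdim S ≤ m := by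
  let g : TopologicalSpace.IrreducibleCloseds S → ℕ := fun c => dm (cn (Subtype.val '' (c : Set S)))
  have hcl : ∀ c : TopologicalSpace.IrreducibleCloseds S,
      g c = dm (cn (closure (Subtype.val '' (c : Set S)))) := fun c => (dm_cn_closure _).symm
  have hg : StrictMono g := by
    intro c d hcd
    have h1 := TopologicalSpace.IrreducibleCloseds.map_strictMono_of_isInducing
      (Topology.IsInducing.subtypeVal (t := S)) hcd
    rw [hcl, hcl]
    exact dm_cn_lt isClosed_closure
      (c.isIrreducible.image _ continuous_subtype_val.continuousOn).closure
      (d.isIrreducible.image _ continuous_subtype_val.continuousOn).closure h1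
  refine iSup_le fun p => ?_
  have h1 := (p.map g hg).head_add_length_le_nat
  have h2 : (p.map g hg).last ≤ m + 1 := by
    rw [LTSeries.last_map]
    exact h _ (by rintro _ ⟨x, -, rfl⟩; exact x.2)
      (p.last.isIrreducible.image _ continuous_subtype_val.continuousOn)
  have h3 : 1 ≤ (p.map g hg).head := by
    rw [LTSeries.head_map, hcl]
    obtain ⟨x, hx⟩ := p.head.isIrreducible.nonempty
    rw [← dm_cn_singleton (x : PS k n)]
    exact dm_cn_mono (by
      rintro _ rfl
      exact subset_closure ⟨x, hx, rfl⟩)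
  rw [LTSeries.map_length] at h1
  exact_mod_cast (by omega : p.length ≤ m)

/-- The projective points of an affine set. -/
def proj (E : Set (Fin n → k)) : Set (PS k n) := {p | ∃ v ∈ E, ∃ hv : v ≠ 0,
    Projectivization.mk k v hv = p}

theorem isIrreducible_proj {E : Set (Fin n → k)} (hE : Irr E) (h0 : (0 : Fin n → k) ∉ E) :
    IsIrreducible (proj E) := by
  constructor
  · obtain ⟨v, hv⟩ := hE.nonempty
    have hv0 : v ≠ 0 := fun h => h0 (h ▸ hv)
    exact ⟨_, v, hv, hv0, rfl⟩
  · rintro U V hU hV ⟨_, ⟨v, hv, hv0, rfl⟩, hvU⟩ ⟨_, ⟨w, hw, hw0, rfl⟩, hwV⟩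
    obtain ⟨d, f, hf, h1, h2⟩ := exists_homog_of_isOpen hU hv0 hvU
    obtain ⟨e, g, hg, h3, h4⟩ := exists_homog_of_isOpen hV hw0 hwV
    have : ∃ x ∈ E, eval x f ≠ 0 ∧ eval x g ≠ 0 := by
      by_contra! hcon
      have := hE.mem_or (f := f) (g := g) (fun x hx => by
        rw [map_mul, mul_eq_zero]
        exact or_iff_not_imp_left.2 (hcon x hx))
      rcases this with h | h
      · exact h1 (h v hv)
      · exact h3 (h w hw)
    obtain ⟨x, hx, hxf, hxg⟩ := this
    have hx0 : x ≠ 0 := fun h => h0 (h ▸ hx)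
    exact ⟨_, ⟨x, hx, hx0, rfl⟩, h2 x hx0 hxf, h4 x hx0 hxg⟩

end Projective

section Core

variable {k : Type} [Field k] {n : ℕ}

theorem eval_zero_of_punctured_line [Infinite k] {f : MvPolynomial (Fin n) k} {v : Fin n → k}
    (h : ∀ c : k, c ≠ 0 → eval (c • v) f = 0) : eval 0 f = 0 := by
  let Q : Polynomial k := aeval (fun i => Polynomial.C (v i) * Polynomial.X) f
  have hQ : ∀ c, Q.eval c = eval (c • v) f := by
    intro c
    rw [← Polynomial.coe_aeval_eq_eval, ← aeval_eq_eval]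
    simp only [Q]
    rw [MvPolynomial.comp_aeval_apply]
    congr 2
    ext i
    rw [map_mul]
    simp only [Polynomial.aeval_C, Polynomial.aeval_X]
    exact mul_comm _ _
  have h0 : Q * Polynomial.X = 0 := by
    apply Polynomial.funext
    intro c
    by_cases hc : c = 0
    · simp [hc]
    · simp [hQ, h c hc]
  have hQ0 : Q = 0 := (mul_eq_zero.1 h0).resolve_right Polynomial.X_ne_zero
  have := hQ 0
  rw [hQ0, Polynomial.eval_zero, zero_smul] at this
  exact this.symm

theorem vanish_cn_of_ne_zero [Infinite k] {S : Set (PS k n)} (hS : S.Nonempty)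
    {f : MvPolynomial (Fin n) k} (hf : ∀ v ∈ cn S, v ≠ 0 → eval v f = 0) :
    ∀ v ∈ cn S, eval v f = 0 := by
  intro v hv
  by_cases hv0 : v = 0
  · subst hv0
    obtain ⟨p, hp⟩ := hS
    induction p using Projectivization.ind with
    | h w hw =>
      exact eval_zero_of_punctured_line fun c hc =>
        hf _ (smul_mem_cn ((mem_cn_iff hw).2 hp) c) (smul_ne_zero hc hw)
  · exact hf v hv hv0

theorem pspan_eq_span (S : Set (PS k n)) : pspan S = Submodule.span k (cn S) := by
  apply le_antisymm
  · refine iSup₂_le fun p hp => ?_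
    induction p using Projectivization.ind with
    | h v hv =>
      rw [Projectivization.submodule_mk, Submodule.span_singleton_le_iff_mem]
      exact Submodule.subset_span ((mem_cn_iff hv).2 hp)
  · rw [Submodule.span_le]
    intro v hv
    by_cases hv0 : v = 0
    · subst hv0; exact zero_mem _
    · refine Submodule.mem_iSup_of_mem _ (Submodule.mem_iSup_of_mem (hv hv0) ?_)
      rw [Projectivization.submodule_mk]
      exact Submodule.mem_span_singleton_self v

theorem subset_linSet_pspan (S : Set (PS k n)) : S ⊆ linSet (pspan S) := fun p hp =>
  le_iSup₂_of_le (f := fun (p : PS k n) (_ : p ∈ S) => p.submodule) p hp le_rfl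

theorem pspan_mono {S T : Set (PS k n)} (h : S ⊆ T) : pspan S ≤ pspan T := by
  rw [pspan_eq_span, pspan_eq_span]; exact Submodule.span_mono (cn_mono h)

theorem pspan_le_iff {S : Set (PS k n)} {W : Submodule k (Fin n → k)} :
    pspan S ≤ W ↔ S ⊆ linSet W := iSup₂_le_iff

/-- The pairs `(l c + t, c)` with `t` and `c` in the cones over `T` and `C`. -/
def secPairs (C T : Set (PS k n)) : Set (Fin n ⊕ Fin n → k) :=
  pmap (Sum.elim (fun i => X (.inr (.inr ())) * X (.inr (.inl i)) + X (.inl i))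
    (fun i => X (.inr (.inl i)))) '' prodSet (cn T) (prodSet (cn C) (Set.univ : Set (Unit → k)))

theorem forall_secPairs {C T : Set (PS k n)} {P : (Fin n ⊕ Fin n → k) → Prop} :
    (∀ v ∈ secPairs C T, P v) ↔
      ∀ t ∈ cn T, ∀ c ∈ cn C, ∀ l : k, P (Sum.elim (l • c + t) c) := by
  rw [secPairs, Set.forall_mem_image, forall_prodSet]
  refine forall₂_congr fun t ht => ?_
  rw [forall_prodSet]
  refine forall₂_congr fun c hc => ?_
  have hev : ∀ l : Unit → k, pmap (Sum.elim (fun i => X (.inr (.inr ())) * X (.inr (.inl i)) + X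
      (.inl i))
    (fun i => X (.inr (.inl i)))) (Sum.elim t (Sum.elim c l)) = Sum.elim (l () • c + t) c := by
    intro l
    ext (i | i) <;> simp [pmap]
  constructor
  · intro h l
    have := h (fun _ => l) trivial
    rwa [hev] at this
  · intro h l _
    rw [hev]; exact h _

/-- Points `o` such that infinitely many points of `C` are collinear with `o` and
another point of `T`. -/
def bisecantPts (C T : Set (PS k n)) : Set (PS k n) :=
  {o | {c | c ∈ C ∧ ∃ t ∈ T, t ≠ c ∧ t.submodule ≤ o.submodule ⊔ c.submodule}.Infinite}

theorem mem_secPairs_of_collinear {C T : Set (PS k n)} {o c : Fin n → k} (ho : o ≠ 0) (hc : c ≠ 0)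
    (hcC : Projectivization.mk k c hc ∈ C) {t : PS k n} (htT : t ∈ T)
    (htc : t ≠ Projectivization.mk k c hc)
    (hle : t.submodule ≤ (Projectivization.mk k o ho).submodule ⊔
      (Projectivization.mk k c hc).submodule) : Sum.elim o c ∈ secPairs C T := by
  induction t using Projectivization.ind with
  | h t ht =>
    simp only [Projectivization.submodule_mk] at hle
    rw [Submodule.span_singleton_le_iff_mem, Submodule.mem_sup] at hle
    obtain ⟨y, hy, z, hz, hyz⟩ := hle
    obtain ⟨a, rfl⟩ := Submodule.mem_span_singleton.1 hy
    obtain ⟨b, rfl⟩ := Submodule.mem_span_singleton.1 hz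
    have ha : a ≠ 0 := by
      rintro rfl
      apply htc
      rw [Projectivization.mk_eq_mk_iff']
      exact ⟨b, by simpa using hyz⟩
    have := (forall_secPairs (P := (· ∈ secPairs C T))).1 (fun v hv => hv) (a⁻¹ • t)
      (smul_mem_cn ((mem_cn_iff ht).2 htT) _) c ((mem_cn_iff hc).2 hcC) (-(a⁻¹ * b))
    convert this using 2
    rw [← hyz, smul_add, smul_smul, smul_smul, inv_mul_cancel₀ ha, neg_smul, one_smul]
    abel

theorem vanish_of_bisecant [Infinite k] {C T P : Set (PS k n)} (hCc : IsClosed C)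
    (hC : IsIrreducible C) (hC2 : dm (cn C) ≤ 2) (hPne : P.Nonempty)
    (hP : P ⊆ closure (bisecantPts C T))
    {F : MvPolynomial (Fin n ⊕ Fin n) k} (hF : ∀ v ∈ secPairs C T, eval v F = 0) :
    ∀ v ∈ prodSet (cn P) (cn C), eval v F = 0 := by
  rw [forall_prodSet]
  intro v hv c hc
  have hne : (bisecantPts C T).Nonempty := closure_nonempty_iff.1 (hPne.mono hP)
  have key : ∀ v ∈ cn (bisecantPts C T), eval v (sliceR c F) = 0 := by
    refine vanish_cn_of_ne_zero hne fun v hv hv0 => ?_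
    rw [eval_sliceR, ← eval_sliceL]
    have hb := hv hv0
    set B := {c | c ∈ C ∧ ∃ t ∈ T, t ≠ c ∧
      t.submodule ≤ (Projectivization.mk k v hv0).submodule ⊔ c.submodule}
    change B.Infinite at hb
    have hBC : closure B = C := by
      by_contra hne
      exact hb ((finite_of_ssubset_curve hC hC2 isClosed_closure
        (LE.le.ssubset_of_ne (closure_minimal (fun x hx => hx.1) hCc) hne)).subset subset_closure)
    rw [← hBC] at hc
    refine vanish_cn_closure (vanish_cn_of_ne_zero hb.nonempty fun c hc hc0 => ?_) c hc
    obtain ⟨hcC, t, ht, htc, hle⟩ := hc hc0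
    rw [eval_sliceL]
    exact hF _ (mem_secPairs_of_collinear hv0 hc0 hcC ht htc hle)
  have := vanish_cn_closure key v (cn_mono hP hv)
  rwa [eval_sliceR] at this

theorem bisecant_core [Infinite k] {C T P : Set (PS k n)} (hCc : IsClosed C)
    (hC : IsIrreducible C) (hC2 : dm (cn C) = 2) (hT : IsIrreducible T) (hT2 : dm (cn T) ≤ 2)
    (hPc : IsClosed P) (hPi : IsIrreducible P) (hP : P ⊆ closure (bisecantPts C T)) :
    dm (cn P) ≤ 3 ∧ (3 ≤ dm (cn P) → ∃ W : Submodule k (Fin n → k), Module.finrank k W = 3 ∧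
      P = linSet W ∧ C ⊆ P ∧ T ⊆ P ∧ W ≤ pspan (C ∪ T)) := by
  have hvan : ∀ F : MvPolynomial (Fin n ⊕ Fin n) k, (∀ v ∈ secPairs C T, eval v F = 0) →
      ∀ v ∈ prodSet (cn P) (cn C), eval v F = 0 := fun F hF =>
    vanish_of_bisecant hCc hC hC2.le hPi.nonempty hP hF
  have hiC := irr_cn hC
  have hiT := irr_cn hT
  have hiP := irr_cn hPi
  have hiCu := irr_prodSet hiC (irr_univ (k := k) (σ := Unit))
  have hiS : Irr (secPairs C T) := (irr_prodSet hiT hiCu).image _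
  have hiPC := irr_prodSet hiP hiC
  have hdS : dm (secPairs C T) ≤ dm (cn T) + 3 := by
    refine (dm_image_le _ _).trans ?_
    rw [dm_prodSet hiT hiCu, dm_prodSet hiC irr_univ, dm_univ, hC2]
    simp
  have hdPC : dm (prodSet (cn P) (cn C)) = dm (cn P) + 2 := by rw [dm_prodSet hiP hiC, hC2]
  have hle := dm_mono hvan
  refine ⟨by omega, fun h3 => ?_⟩
  have hinl : ∀ (p : MvPolynomial (Fin n) k) (v w : Fin n → k),
      eval (Sum.elim v w) (rename Sum.inl p) = eval v p := by
    intro p v w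
    rw [eval_rename]; rfl
  have hsub : ∀ t ∈ cn T, ∀ c ∈ cn C, ∀ l : k, l • c + t ∈ cn P := by
    intro t ht c hc l
    refine mem_cn_of_forall hPc fun p hp => ?_
    have h1 : ∀ v ∈ prodSet (cn P) (cn C), eval v (rename Sum.inl p) = 0 := by
      rw [forall_prodSet]
      intro z hz c hc
      rw [hinl]; exact hp z hz
    have h2 : ∀ v ∈ secPairs C T, eval v (rename Sum.inl p) = 0 := fun v hv =>
      eval_eq_zero_of_dm_le hiPC hiS hvan (by omega) h1 hv
    have := forall_secPairs.1 h2 t ht c hc l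
    rwa [hinl] at this
  have hadd : ∀ z ∈ cn P, ∀ c ∈ cn C, z + c ∈ cn P := by
    intro z hz c hc
    refine mem_cn_of_forall hPc fun p hp => ?_
    let F : MvPolynomial (Fin n ⊕ Fin n) k := aeval (fun i => X (Sum.inl i) + X (Sum.inr i)) p
    have hF : ∀ v w : Fin n → k, eval (Sum.elim v w) F = eval (v + w) p := by
      intro v w
      simp only [F]
      rw [eval_bind]
      congr 2
      ext i; simp [pmap]
    have := forall_prodSet.1 (hvan F (forall_secPairs.2 fun t ht c hc l => by
      rw [hF]
      apply hp
      have := hsub t ht c hc (l + 1)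
      convert this using 1
      rw [add_smul, one_smul]; abel)) z hz c hc
    rwa [hF] at this
  have hspan : ∀ w ∈ pspan C, ∀ z ∈ cn P, z + w ∈ cn P := by
    intro w hw
    rw [pspan_eq_span] at hw
    have : ∀ m : k, ∀ z ∈ cn P, z + m • w ∈ cn P := by
      induction hw using Submodule.span_induction with
      | mem x hx => exact fun m z hz => hadd z hz _ (smul_mem_cn hx m)
      | zero => intro m z hz; simpa using hz
      | add x y _ _ hx hy =>
        intro m z hz
        rw [smul_add, ← add_assoc]
        exact hy m _ (hx m z hz)
      | smul a x _ hx => intro m z hz; rw [smul_smul]; exact hx _ z hz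
    simpa using this 1
  have hTP : cn T ⊆ cn P := fun t ht => by simpa using hsub t ht 0 (zero_mem_cn C) 0
  have hCP : cn C ⊆ cn P := fun c hc => by simpa using hadd 0 (zero_mem_cn P) c hc
  have hLC : 2 ≤ Module.finrank k (pspan C) := by
    rw [← hC2, ← dm_cn_linSet]
    exact dm_cn_mono (subset_linSet_pspan C)
  have hW : ∀ t ∈ cn T, ((pspan C ⊔ Submodule.span k {t} : Submodule k (Fin n → k)) :
      Set (Fin n → k)) ⊆ cn P := by
    intro t ht w hw
    obtain ⟨y, hy, z, hz, rfl⟩ := Submodule.mem_sup.1 hw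
    obtain ⟨a, rfl⟩ := Submodule.mem_span_singleton.1 hz
    rw [add_comm]
    exact hspan y hy _ (hTP (smul_mem_cn ht a))
  by_cases hex : ∃ t ∈ cn T, 3 ≤ Module.finrank k
      (pspan C ⊔ Submodule.span k {t} : Submodule k (Fin n → k))
  · obtain ⟨t, ht, hrk⟩ := hex
    set W : Submodule k (Fin n → k) := pspan C ⊔ Submodule.span k {t} with hWdef
    have hWP : linSet W ⊆ P := subset_of_cn (by rw [cn_linSet]; exact hW t ht)
    have hdW : Module.finrank k W ≤ dm (cn P) := by
      rw [← dm_cn_linSet]; exact dm_cn_mono hWP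
    have hPW : P = linSet W := by
      refine Set.Subset.antisymm (subset_of_cn fun v hv => ?_) hWP
      refine mem_cn_of_forall (isClosed_linSet W) fun p hp => ?_
      have hiW : Irr (cn (linSet W)) := by rw [cn_linSet]; exact (irr_submodule_and_dm W).1
      refine eval_eq_zero_of_dm_le hiW hiP (fun q hq x hx => hq x (cn_mono hWP hx)) ?_ hp hv
      rw [dm_cn_linSet]; omega
    refine ⟨W, by omega, hPW, subset_of_cn hCP, subset_of_cn hTP, ?_⟩
    refine sup_le (pspan_mono Set.subset_union_left) ?_
    rw [Submodule.span_singleton_le_iff_mem, pspan_eq_span]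
    exact Submodule.subset_span (cn_mono Set.subset_union_right ht)
  · push Not at hex
    exfalso
    have hTL : ∀ t ∈ cn T, t ∈ pspan C := by
      intro t ht
      have h1 := hex t ht
      have h2 : pspan C = pspan C ⊔ Submodule.span k {t} :=
        Submodule.eq_of_le_of_finrank_le le_sup_left (by omega)
      rw [h2]
      exact Submodule.mem_sup_right (Submodule.mem_span_singleton_self t)
    have h2 : Module.finrank k (pspan C) ≤ 2 := by
      have := hex 0 (zero_mem_cn T)
      rw [Submodule.span_zero_singleton, sup_bot_eq] at this
      omega
    have : dm (cn P) ≤ dm (cn (linSet (pspan C))) := by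
      refine dm_mono fun p hp z hz => ?_
      have := forall_prodSet.1 (hvan (rename Sum.inl p) (forall_secPairs.2 fun t ht c hc l => by
        rw [hinl]
        apply hp
        rw [cn_linSet]
        refine add_mem (Submodule.smul_mem _ _ ?_) (hTL t ht)
        rw [pspan_eq_span]
        exact Submodule.subset_span hc)) z hz 0 (zero_mem_cn C)
      rwa [hinl] at this
    rw [dm_cn_linSet] at this
    omega

end Core

section Wrapper

variable {k : Type} [Field k] {n : ℕ}

instance : T1Space (PS k n) := ⟨isClosed_point⟩

theorem IsCompOf.isClosed {C Y : Set (PS k n)} (hY : IsClosed Y) (h : IsCompOf C Y) :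
    IsClosed C := by
  have : closure C ⊆ C := h.2 ⟨closure_minimal h.1.1 hY, h.1.2.closure⟩ subset_closure
  exact closure_subset_iff_isClosed.1 this

theorem exists_finite_comps {Y : Set (PS k n)} (hY : IsClosed Y) :
    {C | IsCompOf C Y}.Finite ∧ ∀ y ∈ Y, ∃ C, IsCompOf C Y ∧ y ∈ C := by
  obtain ⟨T, hT, hTc, hTi, hTU⟩ :=
    TopologicalSpace.NoetherianSpace.exists_finite_set_isClosed_irreducible hY
  have hsub : ∀ t ∈ T, t ⊆ Y := fun t ht => hTU ▸ Set.subset_sUnion_of_mem ht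
  have hle : ∀ Z ⊆ Y, IsIrreducible Z → ∃ t ∈ T, Z ⊆ t := by
    intro Z hZ hZi
    exact (isIrreducible_iff_sUnion_isClosed.1 hZi) hT.toFinset (by simpa using hTc)
      (by simpa [← hTU] using hZ) |>.imp (by simp)
  constructor
  · refine hT.subset fun C hC => ?_
    obtain ⟨t, ht, hCt⟩ := hle C hC.1.1 hC.1.2
    have : t ⊆ C := hC.2 ⟨hsub t ht, hTi t ht⟩ hCt
    rwa [Set.Subset.antisymm hCt this]
  · intro y hy
    rw [hTU] at hy
    obtain ⟨t, ht, hyt⟩ := hy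
    obtain ⟨s, hts, hs⟩ := hT.exists_le_maximal ht
    refine ⟨s, ⟨⟨hsub s hs.1, hTi s hs.1⟩, ?_⟩, hts hyt⟩
    intro Z hZ hsZ
    obtain ⟨r, hr, hZr⟩ := hle Z hZ.1 hZ.2
    exact le_trans hZr (hs.2 hr (le_trans hsZ hZr))

theorem exists_bisecantPts_of_segrePt {Y : Set (PS k n)} (hY : IsClosed Y)
    (hinf : ∀ C, IsCompOf C Y → C.Infinite) {o : PS k n} (ho : SegrePt Y o) :
    ∃ C T, IsCompOf C Y ∧ IsCompOf T Y ∧ o ∈ bisecantPts C T := by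
  by_contra! hcon
  obtain ⟨hfin, hcov⟩ := exists_finite_comps hY
  let bad : Set (PS k n) := ⋃ C ∈ {C | IsCompOf C Y}, ⋃ T ∈ {T | IsCompOf T Y},
    {c | c ∈ C ∧ ∃ t ∈ T, t ≠ c ∧ t.submodule ≤ o.submodule ⊔ c.submodule}
  have hbad : bad.Finite := hfin.biUnion fun C hC => hfin.biUnion fun T hT =>
    Set.not_infinite.1 (hcon C T hC hT)
  refine ho.2 ⟨badᶜ, hbad.isClosed.isOpen_compl, ?_, ?_⟩
  · intro y hy
    obtain ⟨C, hC, hyC⟩ := hcov y hy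
    have hne : (C ∩ badᶜ).Nonempty := ((hinf C hC).sdiff hbad).nonempty
    exact closure_mono (Set.inter_subset_inter_left _ hC.1.1)
      (subset_closure_inter_of_isPreirreducible_of_isOpen hC.1.2.isPreirreducible
        hbad.isClosed.isOpen_compl hne hyC)
  · rintro y ⟨hy, hyb⟩ y' hy' hle
    by_contra hne
    obtain ⟨C, hC, hyC⟩ := hcov y hy
    obtain ⟨T, hT, hyT⟩ := hcov y' hy'
    exact hyb (Set.mem_biUnion hC (Set.mem_biUnion hT ⟨hyC, y', hyT, hne, hle⟩))

theorem exists_subset_closure_bisecantPts {Y : Set (PS k n)} (hY : IsClosed Y)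
    (hinf : ∀ C, IsCompOf C Y → C.Infinite) {P : Set (PS k n)} (hP : IsIrreducible P)
    (hPs : P ⊆ segreLocus Y) :
    ∃ C T, IsCompOf C Y ∧ IsCompOf T Y ∧ P ⊆ closure (bisecantPts C T) := by
  obtain ⟨hfin, -⟩ := exists_finite_comps hY
  have hF := (hfin.prod hfin).image fun p => closure (bisecantPts p.1 p.2)
  have hsub : segreLocus Y ⊆
      ⋃₀ ((fun p : Set (PS k n) × Set (PS k n) => closure (bisecantPts p.1 p.2)) ''
        ({C | IsCompOf C Y} ×ˢ {C | IsCompOf C Y})) := by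
    refine closure_minimal ?_ ?_
    · intro o ho
      obtain ⟨C, T, hC, hT, hoC⟩ := exists_bisecantPts_of_segrePt hY hinf ho
      exact ⟨_, ⟨(C, T), ⟨hC, hT⟩, rfl⟩, subset_closure hoC⟩
    · rw [Set.sUnion_eq_biUnion]
      refine hF.isClosed_biUnion ?_
      rintro _ ⟨p, -, rfl⟩; exact isClosed_closure
  obtain ⟨Z, hZ, hPZ⟩ := (isIrreducible_iff_sUnion_isClosed.1 hP) hF.toFinset
    (by
      intro Z hZ
      rw [Set.Finite.mem_toFinset] at hZ
      obtain ⟨p, -, rfl⟩ := hZ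
      exact isClosed_closure)
    (by rw [Set.Finite.coe_toFinset]; exact hPs.trans hsub)
  rw [Set.Finite.mem_toFinset] at hZ
  obtain ⟨⟨C, T⟩, ⟨hC, hT⟩, rfl⟩ := hZ
  exact ⟨C, T, hC, hT, hPZ⟩

theorem segreLocus_dim_and_planes [IsAlgClosed k] {Y : Set (PS k n)} (hY : IsClosed Y)
    (h2 : ∀ Z ⊆ Y, IsIrreducible Z → dm (cn Z) ≤ 2) (hinf : ∀ C, IsCompOf C Y → C.Infinite) :
    pdim (segreLocus Y) ≤ 2 ∧
      ∀ Pl : Set (PS k n), Maximal (fun Z => Z ⊆ segreLocus Y ∧ IsIrreducible Z) Pl →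
        pdim Pl = 2 →
        IsLin Pl 2 ∧ Pl = linSet (pspan (⋃₀ {C | IsCompOf C Y ∧ C ⊆ Pl})) := by
  have hcore : ∀ P ⊆ segreLocus Y, IsIrreducible P → IsClosed P →
      dm (cn P) ≤ 3 ∧ (3 ≤ dm (cn P) → ∃ W : Submodule k (Fin n → k),
        Module.finrank k W = 3 ∧ P = linSet W ∧ ∃ C T, IsCompOf C Y ∧ IsCompOf T Y ∧
          C ⊆ P ∧ T ⊆ P ∧ W ≤ pspan (C ∪ T)) := by
    intro P hPs hPi hPc
    obtain ⟨C, T, hC, hT, hPC⟩ := exists_subset_closure_bisecantPts hY hinf hPi hPs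
    have hC2 : dm (cn C) = 2 := by
      refine le_antisymm (h2 C hC.1.1 hC.1.2) ?_
      by_contra! hlt
      obtain ⟨p, rfl⟩ := eq_singleton_of_dm_le hC.1.2 (by omega)
      exact hinf _ hC (Set.finite_singleton p)
    obtain ⟨ha, hb⟩ := bisecant_core (C := C) (T := T) (P := P) (hC.isClosed hY) hC.1.2
      hC2 hT.1.2 (h2 T hT.1.1 hT.1.2) hPc hPi hPC
    refine ⟨ha, fun h => ?_⟩
    obtain ⟨W, hW, hP, hCP, hTP, hWl⟩ := hb h
    exact ⟨W, hW, hP, C, T, hC, hT, hCP, hTP, hWl⟩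
  constructor
  · refine pdim_le (m := 2) fun Z hZ hZi => ?_
    rw [← dm_cn_closure]
    exact (hcore _ (closure_minimal hZ isClosed_closure) hZi.closure isClosed_closure).1
  · intro P hP hP2
    have hPc : IsClosed P := closure_subset_iff_isClosed.1
      (hP.2 ⟨closure_minimal hP.1.1 isClosed_closure, hP.1.2.closure⟩ subset_closure)
    have h3 : 3 ≤ dm (cn P) := by
      by_contra! hlt
      have : pdim P ≤ (1 : ℕ) := pdim_le fun Z hZ _ => (dm_cn_mono hZ).trans (by omega)
      rw [hP2] at this
      exact absurd this (by decide)
    obtain ⟨W, hW, hPW, C, T, hC, hT, hCP, hTP, hle⟩ := (hcore P hP.1.1 hP.1.2 hPc).2 h3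
    refine ⟨⟨W, hW, hPW⟩, ?_⟩
    conv_lhs => rw [hPW]
    congr 1
    refine le_antisymm (hle.trans (pspan_mono ?_)) (pspan_le_iff.2 ?_)
    · exact Set.union_subset (Set.subset_sUnion_of_mem ⟨hC, hCP⟩)
        (Set.subset_sUnion_of_mem ⟨hT, hTP⟩)
    · rw [← hPW]; exact Set.sUnion_subset fun Z hZ => hZ.2

end Wrapper

section KrullDim

theorem trdeg_eq_of_integral {k S : Type} [Field k] [CommRing S] [IsDomain S] [Algebra k S] {s : ℕ}
    (g : MvPolynomial (Fin s) k →ₐ[k] S) (hg : Function.Injective g) (hi : g.IsIntegral) :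
    Algebra.trdeg k S = s := by
  let := g.toRingHom.toAlgebra
  have : IsScalarTower k (MvPolynomial (Fin s) k) S :=
    IsScalarTower.of_algebraMap_eq fun x => (g.commutes x).symm
  have : FaithfulSMul (MvPolynomial (Fin s) k) S := (faithfulSMul_iff_algebraMap_injective _ _).2 hg
  have : Algebra.IsIntegral (MvPolynomial (Fin s) k) S := ⟨hi⟩
  rw [← trdeg_add_eq k (MvPolynomial (Fin s) k) (A := S),
    trdeg_eq_zero (R := MvPolynomial (Fin s) k) (A := S),
    MvPolynomial.trdeg_of_isDomain]
  simp

theorem toNat_trdeg_le_ringKrullDim (k S : Type) [Field k] [CommRing S] [IsDomain S] [Algebra k S]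
    [Algebra.FiniteType k S] : ((Algebra.trdeg k S).toNat : WithBot ℕ∞) ≤ ringKrullDim S := by
  obtain ⟨s, g, hg, hi⟩ := exists_integral_inj_algHom_of_fg k S
  rw [trdeg_eq_of_integral g hg hi]
  let := g.toRingHom.toAlgebra
  have : FaithfulSMul (MvPolynomial (Fin s) k) S := (faithfulSMul_iff_algebraMap_injective _ _).2 hg
  have : Algebra.IsIntegral (MvPolynomial (Fin s) k) S := ⟨hi⟩
  have hs : (s : WithBot ℕ∞) ≤ ringKrullDim (MvPolynomial (Fin s) k) := by
    rw [MvPolynomial.ringKrullDim_of_isNoetherianRing]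
    simp
  obtain ⟨l, hl⟩ := Order.le_krullDim_iff.1 hs
  obtain ⟨⟨P, hP, hPl⟩⟩ := Ideal.nonempty_primesOver (S := S) l.head.asIdeal
  obtain ⟨L, hL, -⟩ := Ideal.exists_ltSeries_of_hasGoingUp l P
  simp only [Cardinal.toNat_natCast]
  exact Order.le_krullDim_iff.2 ⟨L, hL.trans hl⟩

end KrullDim

section ProjDim

variable {k : Type} [Field k] {n : ℕ}

/-- The homogenisation with respect to the variable `i`. -/
def homogenise (i : Fin n) (f : MvPolynomial (Fin n) k) : MvPolynomial (Fin n) k :=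
  ∑ d ∈ Finset.range (f.totalDegree + 1), X i ^ (f.totalDegree - d) * homogeneousComponent d f

theorem isHomogeneous_homogenise (i : Fin n) (f : MvPolynomial (Fin n) k) :
    (homogenise i f).IsHomogeneous f.totalDegree := by
  refine IsHomogeneous.sum _ _ _ fun d hd => ?_
  have h := ((isHomogeneous_X k i).pow (f.totalDegree - d)).mul
    (homogeneousComponent_isHomogeneous d f)
  rw [Finset.mem_range] at hd
  rwa [show 1 * (f.totalDegree - d) + d = f.totalDegree by omega] at h

theorem eval_homogenise {i : Fin n} (f : MvPolynomial (Fin n) k) {v : Fin n → k} (hv : v i = 1) :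
    eval v (homogenise i f) = eval v f := by
  conv_rhs => rw [← sum_homogeneousComponent f]
  simp [homogenise, hv]

theorem eval_homogenise_of_ne_zero {i : Fin n} (f : MvPolynomial (Fin n) k) {v : Fin n → k}
    (hv : v i ≠ 0) : eval v (homogenise i f) = v i ^ f.totalDegree * eval ((v i)⁻¹ • v) f := by
  have h1 : ((v i)⁻¹ • v) i = 1 := by simp [hv]
  rw [← eval_homogenise f h1, ← eval_smul_of_isHomogeneous (isHomogeneous_homogenise i f),
    smul_inv_smul₀ hv]

theorem exists_coord {Z : Set (PS k n)} (hZ : Z.Nonempty) : ∃ i, ∃ v ∈ cn Z, v i ≠ 0 := by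
  obtain ⟨p, hp⟩ := hZ
  induction p using Projectivization.ind with
  | h v hv =>
    obtain ⟨i, hi⟩ := Function.ne_iff.1 hv
    exact ⟨i, v, (mem_cn_iff hv).2 hp, hi⟩

theorem vanish_cn_of_chart [Infinite k] {Z : Set (PS k n)} (hZ : IsIrreducible Z) {i : Fin n}
    (hi : ∃ v ∈ cn Z, v i ≠ 0) {f : MvPolynomial (Fin n) k}
    (h : ∀ v ∈ cn Z, v i ≠ 0 → eval v f = 0) : ∀ v ∈ cn Z, eval v f = 0 := by
  refine ((irr_cn hZ).mem_or (f := X i) (g := f) fun v hv => ?_).resolve_left ?_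
  · rw [map_mul, mul_eq_zero]
    exact or_iff_not_imp_left.2 fun hvi => h v hv (by simpa using hvi)
  · intro hX
    obtain ⟨v, hv, hvi⟩ := hi
    exact hvi (by simpa using hX v hv)

theorem irr_chart [Infinite k] {Z : Set (PS k n)} (hZ : IsIrreducible Z) {i : Fin n}
    (hi : ∃ v ∈ cn Z, v i ≠ 0) : Irr {v ∈ cn Z | v i = 1} := by
  have hU : ∀ v ∈ cn Z, v i ≠ 0 → (v i)⁻¹ • v ∈ {v ∈ cn Z | v i = 1} := fun v hv hvi =>
    ⟨smul_mem_cn hv _, by simp [hvi]⟩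
  apply irr_of
  · obtain ⟨v, hv, hvi⟩ := hi
    exact ⟨_, hU v hv hvi⟩
  · intro f g hfg
    have := (irr_cn hZ).mem_or (f := homogenise i f) (g := homogenise i g)
      (vanish_cn_of_chart hZ hi fun v hv hvi => by
        rw [map_mul, eval_homogenise_of_ne_zero f hvi, eval_homogenise_of_ne_zero g hvi,
          mul_mul_mul_comm, hfg _ (hU v hv hvi), mul_zero])
    refine this.imp ?_ ?_ <;> intro h x hx <;> have := h x hx.1 <;>
      rwa [eval_homogenise _ hx.2] at this

theorem dm_cn_le_dm_chart [Infinite k] {Z : Set (PS k n)} (hZ : IsIrreducible Z) {i : Fin n}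
    (hi : ∃ v ∈ cn Z, v i ≠ 0) : dm (cn Z) ≤ dm {v ∈ cn Z | v i = 1} + 1 := by
  have h1 := dm_prodSet (irr_chart hZ hi) (irr_univ (k := k) (σ := Unit))
  have h2 := dm_image_le (fun j : Fin n => X (.inr ()) * X (.inl j))
    (prodSet {v ∈ cn Z | v i = 1} (Set.univ : Set (Unit → k)))
  rw [h1, dm_univ, Nat.card_unique] at h2
  refine le_trans (dm_mono fun p hp => vanish_cn_of_chart hZ hi fun v hv hvi => hp v ?_) h2
  refine ⟨Sum.elim ((v i)⁻¹ • v) (fun _ => v i), elim_mem_prodSet ⟨smul_mem_cn hv _,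
      by simp [hvi]⟩ trivial, ?_⟩
  ext j
  simp [pmap, hvi]

theorem proj_zeroLocus_subset {E : Set (Fin n → k)} {Z : Set (PS k n)} (h : E ⊆ cn Z) :
    proj E ⊆ Z := by
  rintro _ ⟨v, hv, hv0, rfl⟩
  exact (mem_cn_iff hv0).1 (h hv)

theorem dm_chart_le_pdim [IsAlgClosed k] {Z : Set (PS k n)} (hZc : IsClosed Z)
    (hZ : IsIrreducible Z) {i : Fin n} (hi : ∃ v ∈ cn Z, v i ≠ 0) :
    (dm {v ∈ cn Z | v i = 1} : WithBot ℕ∞) ≤ pdim Z := by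
  set U := {v ∈ cn Z | v i = 1} with hUdef
  have hU : Irr U := irr_chart hZ hi
  have := hU.isDomain
  let Q : PrimeSpectrum (CR U) → Ideal (MvPolynomial (Fin n) k) :=
    fun P => P.asIdeal.comap (Ideal.Quotient.mkₐ k (vanishingIdeal k U))
  have hQp : ∀ P, (Q P).IsPrime := fun P => Ideal.comap_isPrime _ _
  have hIQ : ∀ P, vanishingIdeal k (zeroLocus k (Q P)) = Q P := fun P =>
    MvPolynomial.IsPrime.vanishingIdeal_zeroLocus _ (h := hQp P)
  have hUQ : ∀ P, vanishingIdeal k U ≤ Q P := by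
    intro P f hf
    change Ideal.Quotient.mkₐ k (vanishingIdeal k U) f ∈ P.asIdeal
    rw [mk_eq_zero_iff.2 (mem_vI.1 hf)]
    exact zero_mem _
  have hmem : ∀ P, zeroLocus k (Q P) ⊆ U := by
    intro P v hv
    have hev : ∀ f ∈ Q P, eval v f = 0 := fun f hf => by simpa [aeval_eq_eval] using hv f hf
    refine ⟨mem_cn_of_forall hZc fun p hp => hev p (hUQ P (mem_vI.2 fun x hx => hp x hx.1)), ?_⟩
    have := hev (X i - 1) (hUQ P (mem_vI.2 fun x hx => by simp [hx.2]))
    simpa [sub_eq_zero] using this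
  have h0 : ∀ P, (0 : Fin n → k) ∉ zeroLocus k (Q P) := fun P h => by
    simpa using (hmem P h).2
  have hirr : ∀ P, IsIrreducible (closure (proj (zeroLocus k (Q P)))) := fun P =>
    (isIrreducible_proj (by rw [Irr, hIQ]; exact hQp P) (h0 P)).closure
  have hsub : ∀ P, closure (proj (zeroLocus k (Q P))) ⊆ Z := fun P =>
    closure_minimal (proj_zeroLocus_subset ((hmem P).trans fun v hv => hv.1)) hZc
  let g : (PrimeSpectrum (CR U))ᵒᵈ → TopologicalSpace.IrreducibleCloseds Z := fun P =>
    { carrier := Subtype.val ⁻¹' closure (proj (zeroLocus k (Q (OrderDual.ofDual P))))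
      isIrreducible' := by
        obtain ⟨⟨p, hp⟩, h2⟩ := hirr (OrderDual.ofDual P)
        refine ⟨⟨⟨p, hsub _ hp⟩, hp⟩, ?_⟩
        rintro _ _ ⟨u, hu, rfl⟩ ⟨v, hv, rfl⟩ ⟨x, hx, hxu⟩ ⟨y, hy, hyv⟩
        obtain ⟨z, hz, hzu⟩ := h2 u v hu hv ⟨x, hx, hxu⟩ ⟨y, hy, hyv⟩
        exact ⟨⟨z, hsub _ hz⟩, hz, hzu⟩
      isClosed' := isClosed_closure.preimage continuous_subtype_val }
  have hg : StrictMono g := by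
    intro P P' hlt
    have hlt' : Q (OrderDual.ofDual P') < Q (OrderDual.ofDual P) :=
      lt_of_le_of_ne (Ideal.comap_mono hlt.le) fun h => hlt.ne <| by
        refine OrderDual.ofDual.injective (PrimeSpectrum.ext ?_)
        exact (Ideal.comap_injective_of_surjective _ (Ideal.Quotient.mkₐ_surjective k _) h).symm
    obtain ⟨hle, f, hf, hf'⟩ := SetLike.lt_iff_le_and_exists.1 hlt'
    have hf'' := hf'
    rw [← hIQ, mem_vI] at hf''
    push Not at hf''
    obtain ⟨v, hv, hvf⟩ := hf''
    have hv1 : v i = 1 := (hmem _ hv).2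
    have hv0 : v ≠ 0 := fun h => h0 _ (h ▸ hv)
    have hVf : closure (proj (zeroLocus k (Q (OrderDual.ofDual P)))) ⊆ V0 (homogenise i f) := by
      refine closure_minimal ?_ (isClosed_V0 (isHomogeneous_homogenise i f))
      rintro _ ⟨w, hw, hw0, rfl⟩
      rw [mem_V0_iff (isHomogeneous_homogenise i f), eval_homogenise _ (hmem _ hw).2]
      simpa [aeval_eq_eval] using hw f hf
    have hvm : Projectivization.mk k v hv0 ∈ closure (proj (zeroLocus k (Q (OrderDual.ofDual P'))))
        :=
      subset_closure ⟨v, hv, hv0, rfl⟩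
    refine lt_of_le_not_ge ?_ ?_
    · intro x hx
      refine closure_mono ?_ hx
      rintro _ ⟨w, hw, hw0, rfl⟩
      exact ⟨w, fun p hp => hw p (hle hp), hw0, rfl⟩
    · intro h
      have := hVf (h (show (⟨_, hsub _ hvm⟩ : Z) ∈ g P' from hvm))
      rw [mem_V0_iff (isHomogeneous_homogenise i f), eval_homogenise _ hv1] at this
      exact hvf this
  have h1 : ((Algebra.trdeg k (CR U)).toNat : WithBot ℕ∞) ≤ ringKrullDim (CR U) :=
    toNat_trdeg_le_ringKrullDim k (CR U)
  refine h1.trans ?_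
  rw [ringKrullDim, ← Order.krullDim_orderDual]
  exact Order.krullDim_le_of_strictMono g hg

theorem dm_cn_le_of_pdim [IsAlgClosed k] {Z : Set (PS k n)} (hZc : IsClosed Z)
    (hZ : IsIrreducible Z) {m : ℕ} (h : pdim Z = m) : dm (cn Z) ≤ m + 1 := by
  obtain ⟨i, hi⟩ := exists_coord hZ.nonempty
  have := dm_chart_le_pdim hZc hZ hi
  rw [h] at this
  exact (dm_cn_le_dm_chart hZ hi).trans (Nat.succ_le_succ (by exact_mod_cast this))

end ProjDim

section GenericNoether

theorem exists_transcendental_integral {K S : Type} [Field K] [CommRing S] [IsDomain S] [Algebra K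
    S]
    [Algebra.FiniteType K S] (h : Algebra.trdeg K S = 1) :
    ∃ t : S, Transcendental K t ∧ (Polynomial.aeval t : Polynomial K →ₐ[K] S).IsIntegral := by
  obtain ⟨s, g, hg, hi⟩ := exists_integral_inj_algHom_of_fg K S
  obtain rfl : s = 1 := by
    have := trdeg_eq_of_integral g hg hi
    rw [h] at this
    exact_mod_cast this.symm
  refine ⟨g (X 0), ?_, ?_⟩
  · have := ((MvPolynomial.algebraicIndependent_X (Fin 1) K).map' (f := g) hg).transcendental 0
    exact this
  · have hc : g = (Polynomial.aeval (g (X 0)) : Polynomial K →ₐ[K] S).comp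
        (aeval fun _ => Polynomial.X) := by
      ext i
      simp [Subsingleton.elim i 0]
    have hi' : (((Polynomial.aeval (g (X 0)) : Polynomial K →ₐ[K] S) : Polynomial K →+* S).comp
        ((aeval fun _ => Polynomial.X : MvPolynomial (Fin 1) K →ₐ[K] Polynomial K) :
          MvPolynomial (Fin 1) K →+* Polynomial K)).IsIntegral := by
      intro x
      have := hi x
      rw [hc] at this
      exact this
    exact RingHom.IsIntegral.tower_top _ _ hi'

theorem exists_aeval_mul_isIntegral {A B : Type} [CommRing A] [IsDomain A] [CommRing B] [IsDomain B]
    [Algebra A B] [FaithfulSMul A B] [Algebra.FiniteType A B] (h : Algebra.trdeg A B = 1) :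
    ∃ b : B, Function.Injective (Polynomial.aeval b : Polynomial A →ₐ[A] B) ∧ ∀ x : B, ∃ a : A,
      a ≠ 0 ∧ (Polynomial.aeval b : Polynomial A →ₐ[A] B).toRingHom.IsIntegralElem
        (algebraMap A B a * x) := by
  let M := Algebra.algebraMapSubmonoid B (nonZeroDivisors A)
  have hM : M ≤ nonZeroDivisors B := by
    rintro _ ⟨a, ha, rfl⟩
    exact mem_nonZeroDivisors_of_ne_zero (by
      simpa using nonZeroDivisors.ne_zero ha)
  let K := Localization (nonZeroDivisors A)
  let _ : Field K := inferInstanceAs (Field (FractionRing A))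
  let S := Localization M
  have : IsDomain S := IsLocalization.isDomain_localization hM
  have : IsLocalization (Submonoid.map (algebraMap A B) (nonZeroDivisors A)) S :=
    inferInstanceAs (IsLocalization M S)
  have hf := RingHom.finiteType_localizationPreserves (algebraMap A B) (nonZeroDivisors A) K S
    (RingHom.finiteType_algebraMap.mpr inferInstance)
  have : Algebra.FiniteType K S := RingHom.finiteType_algebraMap.mp hf
  have hBS : Function.Injective (algebraMap B S) := IsLocalization.injective S hM
  have hAS : Function.Injective (algebraMap A S) := by
    rw [IsScalarTower.algebraMap_eq A B S]
    exact hBS.comp (FaithfulSMul.algebraMap_injective A B)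
  have : FaithfulSMul B S := (faithfulSMul_iff_algebraMap_injective B S).2 hBS
  have : FaithfulSMul A S := (faithfulSMul_iff_algebraMap_injective A S).2 hAS
  have : FaithfulSMul A K := inferInstanceAs (FaithfulSMul A (FractionRing A))
  have : FaithfulSMul K S :=
    (faithfulSMul_iff_algebraMap_injective K S).2 (algebraMap K S).injective
  have hS : Algebra.trdeg K S = 1 := by
    have : Algebra.IsAlgebraic A K := IsLocalization.isAlgebraic _ (nonZeroDivisors A)
    have : Algebra.IsAlgebraic B S := IsLocalization.isAlgebraic _ M
    have h1 := trdeg_add_eq A B (A := S)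
    have h2 := trdeg_add_eq A K (A := S)
    have h3 : Algebra.trdeg A K = 0 := trdeg_eq_zero
    have h4 : Algebra.trdeg B S = 0 := trdeg_eq_zero
    rw [h, h4, add_zero] at h1
    rw [h3, zero_add] at h2
    rw [h2, ← h1]
  obtain ⟨t, ht, hti⟩ := exists_transcendental_integral hS
  obtain ⟨b, ⟨_, a₀, ha₀, rfl⟩, hbt⟩ := IsLocalization.exists_mk'_eq M t
  have ha₀' : algebraMap A K a₀ ≠ 0 := by
    simpa using nonZeroDivisors.ne_zero ha₀
  have hb : algebraMap B S b = algebraMap A K a₀ • t := by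
    rw [← hbt, Algebra.smul_def, ← IsScalarTower.algebraMap_apply, mul_comm,
      IsScalarTower.algebraMap_apply A B S]
    exact (IsLocalization.mk'_spec S b
      (⟨algebraMap A B a₀, Algebra.mem_algebraMapSubmonoid_of_mem ⟨a₀, ha₀⟩⟩ : M)).symm
  let φ : Polynomial K →ₐ[K] S := Polynomial.aeval (algebraMap B S b)
  have hφ : (Polynomial.aeval t : Polynomial K →ₐ[K] S) = φ.comp (Polynomial.aeval
      (Polynomial.C (algebraMap A K a₀)⁻¹ * Polynomial.X)) := by
    ext
    simp only [φ, hb, Polynomial.aeval_X, AlgHom.coe_comp, Function.comp_apply, map_mul,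
      Polynomial.aeval_C]
    rw [← Algebra.smul_def, smul_smul,
      inv_mul_cancel₀ ha₀', one_smul]
  have hφi : (φ : Polynomial K →+* S).IsIntegral := by
    refine RingHom.IsIntegral.tower_top ((Polynomial.aeval
      (Polynomial.C (algebraMap A K a₀)⁻¹ * Polynomial.X) : Polynomial K →ₐ[K] Polynomial K) :
        Polynomial K →+* Polynomial K) _ fun x => ?_
    have := hti x
    rw [hφ] at this
    exact this
  let ψ : Polynomial A →ₐ[A] B := Polynomial.aeval b
  have hψ : (algebraMap B S).comp (ψ : Polynomial A →+* B) =
      (φ : Polynomial K →+* S).comp (Polynomial.mapRingHom (algebraMap A K)) := by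
    ext a
    · simp [ψ, φ, ← IsScalarTower.algebraMap_apply]
    · simp [ψ, φ]
  have hbt' : Transcendental K (algebraMap B S b) := by
    intro hb'
    apply ht
    have : t = (algebraMap A K a₀)⁻¹ • algebraMap B S b := by
      rw [hb, smul_smul, inv_mul_cancel₀ ha₀', one_smul]
    rw [this]
    exact hb'.smul _
  refine ⟨b, ?_, fun x => ?_⟩
  · have h1 : Function.Injective ((φ : Polynomial K →+* S).comp
        (Polynomial.mapRingHom (algebraMap A K))) :=
      (transcendental_iff_injective.1 hbt').comp
        (Polynomial.map_injective _ (FaithfulSMul.algebraMap_injective A K))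
    rw [← hψ] at h1
    exact Function.Injective.of_comp (f := algebraMap B S) h1
  · let _ : Algebra (Polynomial A) (Polynomial K) := Polynomial.algebra A K
    let _ : Algebra (Polynomial K) S := RingHom.toAlgebra (φ : Polynomial K →+* S)
    let _ : Algebra (Polynomial A) S := RingHom.toAlgebra
      ((φ : Polynomial K →+* S).comp (Polynomial.mapRingHom (algebraMap A K)))
    have : IsScalarTower (Polynomial A) (Polynomial K) S := IsScalarTower.of_algebraMap_eq' rfl
    have := Polynomial.isLocalization (nonZeroDivisors A) K
    obtain ⟨⟨_, a, ha, rfl⟩, p, hp, hpx⟩ := IsIntegral.exists_multiple_integral_of_isLocalization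
      ((nonZeroDivisors A).map (Polynomial.C : A →+* Polynomial A)) (algebraMap B S x) (hφi _)
    refine ⟨a, nonZeroDivisors.ne_zero ha, p, hp, hBS ?_⟩
    have h1 : (Polynomial.C a : Polynomial A) • algebraMap B S x =
        algebraMap B S (algebraMap A B a * x) := by
      rw [Algebra.smul_def]
      have := congrArg (fun f => f (Polynomial.C a)) hψ
      simp only [RingHom.comp_apply] at this
      have h2 : algebraMap (Polynomial A) S (Polynomial.C a) = _ := this.symm
      rw [h2, map_mul]
      simp [ψ]
    rw [map_zero, Polynomial.hom_eval₂, ← h1]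
    refine Eq.trans ?_ hpx
    congr 1

end GenericNoether

section GenericFibre

theorem exists_algHom_of_notMem {k B : Type} [Field k] [IsAlgClosed k] [CommRing B] [Algebra k B]
    [Algebra.FiniteType k B] (Q : Ideal B) [Q.IsPrime] {g : B} (hg : g ∉ Q) :
    ∃ χ : B →ₐ[k] k, (∀ y ∈ Q, χ y = 0) ∧ χ g ≠ 0 := by
  have hJ : IsJacobsonRing B := isJacobsonRing_of_finiteType (A := k)
  have hQ : Q.jacobson = Q := isJacobsonRing_iff_prime_eq.1 hJ Q inferInstance
  rw [← hQ, Ideal.jacobson, Ideal.mem_sInf] at hg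
  push Not at hg
  obtain ⟨m, ⟨hQm, hm⟩, hgm⟩ := hg
  let _ : Field (B ⧸ m) := Ideal.Quotient.field m
  have : Module.Finite k (B ⧸ m) := finite_of_finite_type_of_isJacobsonRing k (B ⧸ m)
  let e : k ≃ₐ[k] (B ⧸ m) := AlgEquiv.ofBijective (Algebra.ofId k _)
    IsAlgClosed.algebraMap_bijective_of_isIntegral
  refine ⟨(e.symm : (B ⧸ m) →ₐ[k] k).comp (Ideal.Quotient.mkₐ k m), fun y hy => ?_, ?_⟩
  · simp [Ideal.Quotient.eq_zero_iff_mem.2 (hQm hy)]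
  · simpa [Ideal.Quotient.eq_zero_iff_mem] using hgm

theorem exists_prime_over_integralClosure {C B : Type} [CommRing C] [CommRing B] [IsDomain B]
    [Algebra C B] (c : C) (hc : ∀ x : B, ∃ N : ℕ, IsIntegral C (c ^ N • x))
    (P : Ideal (integralClosure C B)) [hP : P.IsPrime] (hcP : algebraMap C _ c ∉ P) :
    ∃ Q : Ideal B, Q.IsPrime ∧ ∀ y : integralClosure C B, y.1 ∈ Q ↔ y ∈ P := by
  have hpow : ∀ N : ℕ, (algebraMap C (integralClosure C B) c) ^ N ∉ P := fun N h =>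
    hcP (hP.mem_of_pow_mem N h)
  let Q : Ideal B :=
    { carrier := {x | ∃ N : ℕ, ∃ y ∈ P, y.1 = c ^ N • x}
      zero_mem' := ⟨0, 0, zero_mem _, by simp⟩
      add_mem' := by
        rintro x x' ⟨N, y, hy, h⟩ ⟨N', y', hy', h'⟩
        refine ⟨N + N', c ^ N' • y + c ^ N • y', ?_, ?_⟩
        · rw [Algebra.smul_def, Algebra.smul_def]
          exact P.add_mem (P.mul_mem_left _ hy) (P.mul_mem_left _ hy')
        · have : ((c ^ N' • y + c ^ N • y' : integralClosure C B) : B) =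
              c ^ N' • y.1 + c ^ N • y'.1 := rfl
          rw [this, h, h', smul_smul, smul_smul, smul_add, pow_add, mul_comm (c ^ N')]
      smul_mem' := by
        rintro z x ⟨N, y, hy, h⟩
        obtain ⟨M, hM⟩ := hc z
        refine ⟨M + N, ⟨_, hM⟩ * y, P.mul_mem_left _ hy, ?_⟩
        change (c ^ M • z) * y.1 = _
        rw [h, smul_mul_smul_comm, ← pow_add, smul_eq_mul] }
  have hQ : ∀ y : integralClosure C B, y.1 ∈ Q ↔ y ∈ P := by
    intro y
    refine ⟨?_, fun hy => ⟨0, y, hy, by simp⟩⟩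
    rintro ⟨N, y', hy', h⟩
    have : y' = c ^ N • y := Subtype.ext h
    rw [this, Algebra.smul_def, map_pow] at hy'
    exact (hP.mem_or_mem hy').resolve_left (hpow N)
  refine ⟨Q, ?_, hQ⟩
  rw [Ideal.isPrime_iff]
  refine ⟨fun h => ?_, ?_⟩
  · have h1 : (1 : B) ∈ Q := h ▸ Submodule.mem_top
    exact hP.ne_top ((Ideal.eq_top_iff_one P).2 ((hQ 1).1 h1))
  · intro x x' hx
    obtain ⟨M, hM⟩ := hc x
    obtain ⟨M', hM'⟩ := hc x'
    have h1 : (⟨_, hM⟩ * ⟨_, hM'⟩ : integralClosure C B) ∈ P := by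
      rw [← hQ]
      change (c ^ M • x) * (c ^ M' • x') ∈ Q
      rw [smul_mul_smul_comm, Algebra.smul_def]
      exact Q.mul_mem_left _ hx
    rcases hP.mem_or_mem h1 with h | h
    · exact Or.inl ⟨M, _, h, rfl⟩
    · exact Or.inr ⟨M', _, h, rfl⟩

theorem exists_prime_over {C B : Type} [CommRing C] [CommRing B] [IsDomain B] [Algebra C B]
    [FaithfulSMul C B] (c : C) (hc : ∀ x : B, ∃ N : ℕ, IsIntegral C (c ^ N • x))
    (p : Ideal C) [p.IsPrime] (hcp : c ∉ p) :
    ∃ Q : Ideal B, Q.IsPrime ∧ Q.comap (algebraMap C B) = p := by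
  obtain ⟨P, hP, hPp⟩ := Ideal.exists_ideal_over_prime_of_isIntegral_of_isDomain
    (S := integralClosure C B) p (by
      intro x hx
      have h1 : algebraMap C B x = 0 := congrArg Subtype.val ((RingHom.mem_ker).1 hx)
      rw [FaithfulSMul.algebraMap_injective C B (h1.trans (map_zero _).symm)]
      exact zero_mem p)
  obtain ⟨Q, hQ, hQP⟩ := exists_prime_over_integralClosure c hc P (by
    rwa [← Ideal.mem_comap, hPp])
  refine ⟨Q, hQ, ?_⟩
  ext x
  rw [← hPp, Ideal.mem_comap, Ideal.mem_comap, ← hQP]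
  rfl

theorem exists_prime_le_over {C B : Type} [CommRing C] [IsDomain C] [IsIntegrallyClosed C]
    [CommRing B] [IsDomain B] [Algebra C B]
    [FaithfulSMul C B] (c : C) (hc : ∀ x : B, ∃ N : ℕ, IsIntegral C (c ^ N • x))
    (p : Ideal C) [p.IsPrime] (m : Ideal B) [hm : m.IsPrime] (hpm : p ≤ m.comap (algebraMap C B))
    (hcm : algebraMap C B c ∉ m) :
    ∃ Q : Ideal B, Q.IsPrime ∧ Q ≤ m ∧ Q.comap (algebraMap C B) = p := by
  let m' := m.comap (algebraMap (integralClosure C B) B)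
  have : m'.LiesOver (m.comap (algebraMap C B)) := ⟨rfl⟩
  obtain ⟨P, hPm, hP, hPp⟩ := Ideal.exists_ideal_le_liesOver_of_le m' hpm
  have hcP : algebraMap C _ c ∉ P := fun h => hcm (hPm h)
  obtain ⟨Q, hQ, hQP⟩ := exists_prime_over_integralClosure c hc P hcP
  refine ⟨Q, hQ, fun x hx => ?_, ?_⟩
  · obtain ⟨N, hN⟩ := hc x
    have h1 : (⟨_, hN⟩ : integralClosure C B) ∈ P := by
      rw [← hQP]
      change c ^ N • x ∈ Q
      rw [Algebra.smul_def]
      exact Q.mul_mem_left _ hx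
    have h2 : c ^ N • x ∈ m := hPm h1
    rw [Algebra.smul_def, map_pow] at h2
    exact (hm.mem_or_mem h2).resolve_left fun h => hcm (hm.mem_of_pow_mem N h)
  · ext x
    rw [hPp.over, Ideal.mem_comap, Ideal.under, Ideal.mem_comap, ← hQP]
    rfl

theorem exists_pow_smul_isIntegral {k C B : Type} [CommRing k] [CommRing C] [CommRing B]
    [Algebra k C] [Algebra k B] [Algebra C B] [IsScalarTower k C B] {s : Finset B}
    (hs : Algebra.adjoin k (s : Set B) = ⊤) {c : C} (hc : ∀ x ∈ s, IsIntegral C (c • x)) (x : B) :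
    ∃ N : ℕ, IsIntegral C (c ^ N • x) := by
  have hx : x ∈ Algebra.adjoin k (s : Set B) := hs ▸ Algebra.mem_top
  induction hx using Algebra.adjoin_induction with
  | mem x hx => exact ⟨1, by simpa using hc x hx⟩
  | algebraMap r =>
    refine ⟨0, ?_⟩
    rw [pow_zero, one_smul, IsScalarTower.algebraMap_apply k C B]
    exact isIntegral_algebraMap
  | add x y _ _ hx hy =>
    obtain ⟨M, hM⟩ := hx
    obtain ⟨N, hN⟩ := hy
    refine ⟨M + N, ?_⟩
    rw [smul_add]
    refine IsIntegral.add ?_ ?_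
    · rw [add_comm, pow_add, mul_smul]
      exact hM.smul _
    · rw [pow_add, mul_smul]
      exact hN.smul _
  | mul x y _ _ hx hy =>
    obtain ⟨M, hM⟩ := hx
    obtain ⟨N, hN⟩ := hy
    refine ⟨M + N, ?_⟩
    rw [pow_add, ← smul_mul_smul_comm]
    exact hM.mul hN

/-- The fibres of a dominant morphism of relative dimension one over a general point. -/
theorem generic_fibre {k B : Type} [Field k] [IsAlgClosed k] {N : ℕ} [CommRing B] [IsDomain B]
    [Algebra k B] [Algebra.FiniteType k B] (ψ : MvPolynomial (Fin N) k →ₐ[k] B)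
    (hψ : Function.Injective ψ) (h : Algebra.trdeg k B = (N + 1 : ℕ)) :
    ∃ a : MvPolynomial (Fin N) k, a ≠ 0 ∧ ∀ q : Fin N → k, eval q a ≠ 0 →
      (∃ χ : B →ₐ[k] k, ∀ f, χ (ψ f) = eval q f) ∧
      (∀ (D : Type) [CommRing D] [IsDomain D] [Algebra k D] (ρ : B →ₐ[k] D),
        Function.Surjective ρ → (∀ f, ρ (ψ f) = algebraMap k D (eval q f)) →
          Algebra.trdeg k D ≤ 1) ∧
      ∀ χ : B →ₐ[k] k, (∀ f, χ (ψ f) = eval q f) → ∀ g : B, χ g ≠ 0 →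
        {χ' : B →ₐ[k] k | (∀ f, χ' (ψ f) = eval q f) ∧ χ' g ≠ 0}.Infinite := by
  let _ : Algebra (MvPolynomial (Fin N) k) B := ψ.toRingHom.toAlgebra
  have : IsScalarTower k (MvPolynomial (Fin N) k) B :=
      IsScalarTower.of_algebraMap_eq' ψ.comp_algebraMap.symm
  have : FaithfulSMul (MvPolynomial (Fin N) k) B :=
      (faithfulSMul_iff_algebraMap_injective (MvPolynomial (Fin N) k) B).2 hψ
  have : Algebra.FiniteType (MvPolynomial (Fin N) k) B :=
      Algebra.FiniteType.of_restrictScalars_finiteType k (MvPolynomial (Fin N) k) B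
  have htr : Algebra.trdeg (MvPolynomial (Fin N) k) B = 1 := by
    have h1 := trdeg_add_eq k (MvPolynomial (Fin N) k) (A := B)
    have hlt : Algebra.trdeg (MvPolynomial (Fin N) k) B < Cardinal.aleph0 :=
        trdeg_lt_aleph0_of_finiteType
    obtain ⟨t, ht⟩ := Cardinal.lt_aleph0.1 hlt
    rw [MvPolynomial.trdeg_of_isDomain, h, ht] at h1
    rw [ht]
    norm_cast at h1 ⊢
    simp at h1
    norm_cast at h1
    omega
  obtain ⟨b, hb, hi⟩ := exists_aeval_mul_isIntegral htr
  let _ : Algebra (Polynomial (MvPolynomial (Fin N) k)) B :=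
      (Polynomial.aeval b : (Polynomial (MvPolynomial (Fin N) k)) →ₐ[(MvPolynomial (Fin N) k)]
      B).toRingHom.toAlgebra
  have : FaithfulSMul (Polynomial (MvPolynomial (Fin N) k)) B :=
      (faithfulSMul_iff_algebraMap_injective (Polynomial (MvPolynomial (Fin N) k)) B).2 hb
  have hCB : ∀ f : (MvPolynomial (Fin N) k), algebraMap (Polynomial (MvPolynomial (Fin N) k)) B
      (Polynomial.C f) = ψ f := fun f =>
    Polynomial.aeval_C b f
  have : IsScalarTower k (Polynomial (MvPolynomial (Fin N) k)) B :=
    IsScalarTower.of_algebraMap_eq fun r =>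
      ((hCB (MvPolynomial.C r)).trans (ψ.commutes r)).symm
  obtain ⟨a, ha, hai⟩ : ∃ a : (MvPolynomial (Fin N) k), a ≠ 0 ∧ ∀ x : B, ∃ d : ℕ,
      IsIntegral (Polynomial (MvPolynomial (Fin N) k)) ((Polynomial.C a : (Polynomial (MvPolynomial
          (Fin N) k))) ^ d • x) := by
    obtain ⟨s, hs⟩ := Algebra.FiniteType.out (R := k) (A := B)
    choose a ha hai using hi
    classical
    refine ⟨∏ x ∈ s, a x, Finset.prod_ne_zero_iff.2 fun x _ => ha x,
      exists_pow_smul_isIntegral hs fun x hx => ?_⟩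
    have h1 : (Polynomial.C (∏ x ∈ s, a x) : Polynomial (MvPolynomial (Fin N) k)) • x =
        algebraMap (Polynomial (MvPolynomial (Fin N) k)) B
          (Polynomial.C (∏ y ∈ s.erase x, a y)) * (ψ (a x) * x) := by
      rw [Algebra.smul_def, ← Finset.mul_prod_erase s a hx, hCB, hCB, map_mul]
      ring
    rw [h1]
    exact isIntegral_algebraMap.mul (hai x)
  refine ⟨a, ha, fun q hq => ?_⟩
  let ev : (Polynomial (MvPolynomial (Fin N) k)) →+* Polynomial k := Polynomial.mapRingHom (eval q)
  let p : Ideal (Polynomial (MvPolynomial (Fin N) k)) := RingHom.ker ev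
  have : p.IsPrime := RingHom.ker_isPrime ev
  have hap : (Polynomial.C a : (Polynomial (MvPolynomial (Fin N) k))) ∉ p := by
    rw [RingHom.mem_ker, Polynomial.coe_mapRingHom, Polynomial.map_C]
    simpa using hq
  have hpf : ∀ f : (MvPolynomial (Fin N) k), (Polynomial.C (f - MvPolynomial.C (eval q f)) :
      (Polynomial (MvPolynomial (Fin N) k))) ∈ p := fun f => by
    rw [RingHom.mem_ker, Polynomial.coe_mapRingHom, Polynomial.map_C, map_sub, eval_C, sub_self,
      map_zero]
  have hover : ∀ Q : Ideal B, Q.comap (algebraMap (Polynomial (MvPolynomial (Fin N) k)) B) = p →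
      ∀ χ : B →ₐ[k] k,
      (∀ y ∈ Q, χ y = 0) → ∀ f, χ (ψ f) = eval q f := by
    intro Q hQ χ hχ f
    have h1 := hpf f
    rw [← hQ, Ideal.mem_comap, hCB] at h1
    have h2 := hχ _ h1
    rw [map_sub, map_sub, sub_eq_zero] at h2
    rw [h2]
    exact (congrArg χ (ψ.commutes _)).trans (χ.commutes _)
  refine ⟨?_, ?_, ?_⟩
  · obtain ⟨Q, hQ, hQp⟩ := exists_prime_over _ hai p hap
    obtain ⟨χ, hχ, -⟩ := exists_algHom_of_notMem (k := k) Q (g := 1)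
      ((Ideal.ne_top_iff_one Q).1 hQ.ne_top)
    exact ⟨χ, hover Q hQp χ hχ⟩
  · intro D _ _ _ ρ hρ hρq
    let K := Algebra.adjoin k {ρ b}
    let θ : Polynomial k →ₐ[k] K := Polynomial.aeval ⟨ρ b, Algebra.subset_adjoin rfl⟩
    have hθ : (ρ : B →+* D).comp (algebraMap (Polynomial (MvPolynomial (Fin N) k)) B) =
        (algebraMap K D).comp ((θ : Polynomial k →+* K).comp ev) := by
      refine Polynomial.ringHom_ext (fun f => ?_) ?_
      · rw [RingHom.comp_apply, hCB]
        refine (hρq f).trans ?_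
        simp [ev, θ, ← IsScalarTower.algebraMap_apply]
      · rw [RingHom.comp_apply]
        have : algebraMap (Polynomial (MvPolynomial (Fin N) k)) B Polynomial.X = b :=
            Polynomial.aeval_X b
        rw [this]
        simp [ev, θ]
    have : Algebra.IsAlgebraic K D := by
      refine ⟨fun y => IsIntegral.isAlgebraic ?_⟩
      obtain ⟨x, rfl⟩ := hρ y
      obtain ⟨d, P, hP, hPx⟩ := hai x
      have h1 : IsIntegral K (ρ ((Polynomial.C a : (Polynomial (MvPolynomial (Fin N) k))) ^ d • x))
          := by
        refine ⟨P.map ((θ : Polynomial k →+* K).comp ev), hP.map _, ?_⟩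
        rw [Polynomial.eval₂_map, ← hθ]
        have := congrArg ρ hPx
        rw [map_zero] at this
        rw [← this]
        exact (Polynomial.hom_eval₂ P _ (ρ : B →+* D) _).symm
      have h2 : ρ ((Polynomial.C a : (Polynomial (MvPolynomial (Fin N) k))) ^ d • x) =
          (eval q a) ^ d • ρ x := by
        rw [Algebra.smul_def, map_pow, hCB, map_mul, map_pow, hρq, ← map_pow, Algebra.smul_def]
      have h3 : ρ x = ((eval q a) ^ d)⁻¹ • ρ ((Polynomial.C a : (Polynomial (MvPolynomial (Fin N)
          k))) ^ d • x) := by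
        rw [h2, smul_smul, inv_mul_cancel₀ (pow_ne_zero d hq), one_smul]
      rw [h3]
      exact h1.smul _
    have := Algebra.IsAlgebraic.trdeg_le_cardinalMk k ({ρ b} : Set D)
    simpa using this
  · intro χ hχ g hg hfin
    have hpm : p ≤ (RingHom.ker χ).comap (algebraMap (Polynomial (MvPolynomial (Fin N) k)) B) := by
      intro x hx
      have h1 : (χ : B →+* k).comp (algebraMap (Polynomial (MvPolynomial (Fin N) k)) B) =
          (Polynomial.evalRingHom (χ b)).comp ev := by
        refine Polynomial.ringHom_ext (fun f => ?_) ?_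
        · rw [RingHom.comp_apply, hCB]
          refine (hχ f).trans ?_
          simp [ev]
        · rw [RingHom.comp_apply]
          have : algebraMap (Polynomial (MvPolynomial (Fin N) k)) B Polynomial.X = b :=
              Polynomial.aeval_X b
          rw [this]
          simp [ev]
      have h2 := congrArg (fun f => f x) h1
      simp only [RingHom.comp_apply] at h2
      rw [Ideal.mem_comap, RingHom.mem_ker]
      refine h2.trans ?_
      rw [(RingHom.mem_ker).1 hx, map_zero]
    have : (RingHom.ker χ).IsPrime := RingHom.ker_isPrime χ
    obtain ⟨Q, hQ, hQm, hQp⟩ := exists_prime_le_over _ hai p (RingHom.ker χ) hpm (by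
      rw [hCB, RingHom.mem_ker, hχ]
      exact hq)
    have hbQ : ∀ c : k, b - algebraMap k B c ∉ Q := by
      intro c hc
      have h1 : algebraMap (Polynomial (MvPolynomial (Fin N) k)) B (Polynomial.X - Polynomial.C
          (MvPolynomial.C c)) =
          b - algebraMap k B c := by
        rw [map_sub, hCB]
        exact congrArg₂ _ (Polynomial.aeval_X b) (ψ.commutes c)
      rw [← h1, ← Ideal.mem_comap, hQp, RingHom.mem_ker] at hc
      have h2 : ev (Polynomial.X - Polynomial.C (MvPolynomial.C c)) =
          Polynomial.X - Polynomial.C c := by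
        simp [ev]
      exact Polynomial.X_sub_C_ne_zero c (h2.symm.trans hc)
    have hg' : g * ∏ χ' ∈ hfin.toFinset, (b - algebraMap k B (χ' b)) ∉ Q := by
      intro h
      rcases hQ.mem_or_mem h with h | h
      · exact hg (hQm h)
      · obtain ⟨χ', -, h⟩ := (Ideal.IsPrime.prod_mem_iff (hp := hQ)).1 h
        exact hbQ _ h
    obtain ⟨χ', hχ', hχg⟩ := exists_algHom_of_notMem (k := k) Q hg'
    rw [map_mul] at hχg
    have h1 : χ' ∈ hfin.toFinset := by
      rw [Set.Finite.mem_toFinset]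
      exact ⟨hover Q hQp χ' hχ', left_ne_zero_of_mul hχg⟩
    apply right_ne_zero_of_mul hχg
    rw [map_prod]
    exact Finset.prod_eq_zero h1 (by simp)

end GenericFibre

section SumFibre

variable {k : Type} [Field k] {N : ℕ}

/-- The comorphism of the addition map restricted to a product. -/
def sumHom (E : Set (Fin N → k)) : MvPolynomial (Fin N) k →ₐ[k] CR (prodSet E E) :=
  (Ideal.Quotient.mkₐ k _).comp (aeval fun i => X (.inl i) + X (.inr i))

theorem eval_sum (f : MvPolynomial (Fin N) k) (v : Fin N ⊕ Fin N → k) :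
    eval v (aeval (fun i => X (.inl i) + X (.inr i) : Fin N → MvPolynomial (Fin N ⊕ Fin N) k) f) =
      eval ((fun i => v (.inl i)) + fun i => v (.inr i)) f := by
  rw [eval_bind]
  congr 2
  ext i
  simp [pmap]

theorem sumHom_injective {E : Set (Fin N → k)}
    (h : ∀ f : MvPolynomial (Fin N) k, (∀ x ∈ E, ∀ y ∈ E, eval (x + y) f = 0) → f = 0) :
    Function.Injective (sumHom E) := by
  rw [injective_iff_map_eq_zero]
  intro f hf
  refine h f fun x hx y hy => ?_
  have h1 : eval (Sum.elim x y) (aeval (fun i => X (.inl i) + X (.inr i) :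
      Fin N → MvPolynomial (Fin N ⊕ Fin N) k) f) = 0 :=
    mk_eq_zero_iff.1 hf _ (elim_mem_prodSet hx hy)
  rw [eval_sum] at h1
  exact h1

theorem algHom_mk {σ : Type} {E : Set (σ → k)} (χ : CR E →ₐ[k] k) (p : MvPolynomial σ k) :
    χ (Ideal.Quotient.mkₐ k _ p) = eval (fun j => χ (Ideal.Quotient.mkₐ k _ (X j))) p := by
  have : χ.comp (Ideal.Quotient.mkₐ k _) =
      aeval fun j => χ (Ideal.Quotient.mkₐ k (vanishingIdeal k E) (X j)) := by
    ext j
    simp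
  exact DFunLike.congr_fun this p

theorem le_of_sum_dominant {E : Set (Fin N → k)} (hE : Irr E)
    (h : ∀ f : MvPolynomial (Fin N) k, (∀ x ∈ E, ∀ y ∈ E, eval (x + y) f = 0) → f = 0) :
    N ≤ 2 * dm E := by
  have := (irr_prodSet hE hE).isDomain
  have h1 := trdeg_le_of_injective (sumHom E) (sumHom_injective h)
  rw [MvPolynomial.trdeg_of_isDomain] at h1
  have h2 : Algebra.trdeg k (CR (prodSet E E)) = (dm (prodSet E E) : Cardinal) :=
    (dm_cast (prodSet E E)).symm
  rw [h2, dm_prodSet hE hE] at h1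
  simp at h1
  norm_cast at h1
  omega

/-- The points `x` of `E` such that `q - x` also lies in `E`. -/
def sumFibre (E : Set (Fin N → k)) (q : Fin N → k) : Set (Fin N → k) := {x | x ∈ E ∧ q - x ∈ E}

theorem sum_fibre [IsAlgClosed k] {E : Set (Fin N → k)} (hE : Irr E)
    (hEc : ∀ v, (∀ p : MvPolynomial (Fin N) k, (∀ x ∈ E, eval x p = 0) → eval v p = 0) → v ∈ E)
    (hd : 2 * dm E = N + 1)
    (h : ∀ f : MvPolynomial (Fin N) k, (∀ x ∈ E, ∀ y ∈ E, eval (x + y) f = 0) → f = 0) :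
    ∃ a : MvPolynomial (Fin N) k, a ≠ 0 ∧ ∀ q, eval q a ≠ 0 →
      (sumFibre E q).Nonempty ∧ (∀ x ∈ sumFibre E q, ∀ g : MvPolynomial (Fin N) k, eval x g ≠ 0 →
        {y | y ∈ sumFibre E q ∧ eval y g ≠ 0}.Infinite) ∧
      ∃ 𝒢 : Set (Set (Fin N → k)), 𝒢.Finite ∧ (∀ G ∈ 𝒢, Irr G ∧ dm G ≤ 1) ∧
        sumFibre E q ⊆ ⋃₀ 𝒢 := by
  have := (irr_prodSet hE hE).isDomain
  have htr : Algebra.trdeg k (CR (prodSet E E)) = (N + 1 : ℕ) := by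
    have h2 : Algebra.trdeg k (CR (prodSet E E)) = (dm (prodSet E E) : Cardinal) :=
      (dm_cast (prodSet E E)).symm
    rw [h2, dm_prodSet hE hE, ← two_mul, hd]
  obtain ⟨a, ha, H⟩ := generic_fibre (sumHom E) (sumHom_injective h) htr
  refine ⟨a, ha, fun q hq => ?_⟩
  obtain ⟨⟨χ₀, hχ₀⟩, h1, h2⟩ := H q hq
  let μ : MvPolynomial (Fin N ⊕ Fin N) k →ₐ[k] CR (prodSet E E) := Ideal.Quotient.mkₐ k _
  let lt (χ : CR (prodSet E E) →ₐ[k] k) (i : Fin N) : k := χ (μ (X (.inl i)))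
  let rt (χ : CR (prodSet E E) →ₐ[k] k) (i : Fin N) : k := χ (μ (X (.inr i)))
  have hpt : ∀ χ, (∀ f, χ (sumHom E f) = eval q f) →
      lt χ ∈ E ∧ rt χ ∈ E ∧ lt χ + rt χ = q := by
    intro χ hχ
    refine ⟨hEc _ fun p hp => ?_, hEc _ fun p hp => ?_, ?_⟩
    · have : μ (rename Sum.inl p) = 0 := mk_eq_zero_iff.2 (forall_prodSet.2 fun x hx y _ => by
        rw [eval_rename]
        exact hp x hx)
      have h3 := algHom_mk χ (rename Sum.inl p)
      rw [eval_rename] at h3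
      exact h3.symm.trans ((congrArg χ this).trans (map_zero χ))
    · have : μ (rename Sum.inr p) = 0 := mk_eq_zero_iff.2 (forall_prodSet.2 fun x _ y hy => by
        rw [eval_rename]
        exact hp y hy)
      have h3 := algHom_mk χ (rename Sum.inr p)
      rw [eval_rename] at h3
      exact h3.symm.trans ((congrArg χ this).trans (map_zero χ))
    · ext i
      have h3 := hχ (X i)
      simpa [sumHom, lt, rt, μ] using h3
  refine ⟨?_, ?_, ?_⟩
  · obtain ⟨h3, h4, h5⟩ := hpt χ₀ hχ₀
    exact ⟨_, h3, by rwa [← h5, add_sub_cancel_left]⟩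
  · intro x hx g hg
    let χ := crEval (⟨_, elim_mem_prodSet hx.1 hx.2⟩ : prodSet E E)
    have hχ : ∀ f, χ (sumHom E f) = eval q f := fun f => by
      refine (crEval_mk _ _).trans ((eval_sum f _).trans ?_)
      congr 2
      ext i
      simp
    have hχg : ∀ χ : CR (prodSet E E) →ₐ[k] k, χ (μ (rename Sum.inl g)) = eval (lt χ) g :=
      fun χ => by
        refine (algHom_mk χ _).trans ?_
        rw [eval_rename]
        rfl
    have hlt : lt χ = x := by
      ext i
      refine (crEval_mk _ _).trans ?_
      simp
    refine Set.infinite_of_injOn_mapsTo (f := lt) ?_ ?_ (h2 χ hχ (μ (rename Sum.inl g)) (by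
      rw [hχg, hlt]
      exact hg))
    · rintro χ₁ ⟨h3, -⟩ χ₂ ⟨h4, -⟩ h5
      have h6 : rt χ₁ = rt χ₂ := by
        have h7 := (hpt χ₁ h3).2.2
        rw [← (hpt χ₂ h4).2.2, h5] at h7
        exact add_left_cancel h7
      refine Ideal.Quotient.algHom_ext k ?_
      ext j
      rcases j with j | j
      · exact congrFun h5 j
      · exact congrFun h6 j
    · rintro χ' ⟨h3, h4⟩
      obtain ⟨h5, h6, h7⟩ := hpt χ' h3
      refine ⟨⟨h5, ?_⟩, ?_⟩
      · rwa [← h7, add_sub_cancel_left]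
      · rwa [hχg] at h4
  · let F : Set (Fin N ⊕ Fin N → k) := (fun x => Sum.elim x (q - x)) '' sumFibre E q
    let J := vanishingIdeal k F
    let φ : Fin N → MvPolynomial (Fin N ⊕ Fin N) k := fun i => X (.inl i)
    refine ⟨(fun Q => pmap φ '' zeroLocus k Q) '' J.minimalPrimes, ?_, ?_, ?_⟩
    · exact (Ideal.finite_minimalPrimes_of_isNoetherianRing _ J).image _
    · rintro _ ⟨Q, hQ, rfl⟩
      have hQp : Q.IsPrime := hQ.1.1
      have hJQ : J ≤ Q := hQ.1.2
      have hvQ : vanishingIdeal k (zeroLocus k Q) = Q :=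
        MvPolynomial.IsPrime.vanishingIdeal_zeroLocus Q (h := hQp)
      have hirr : Irr (zeroLocus k Q) := by
        unfold Irr
        rwa [hvQ]
      refine ⟨hirr.image φ, (dm_image_le φ _).trans ?_⟩
      have := hirr.isDomain
      have hle : vanishingIdeal k (prodSet E E) ≤ vanishingIdeal k (zeroLocus k Q) := by
        rw [hvQ]
        refine le_trans (fun p hp => ?_) hJQ
        rw [mem_vI] at hp ⊢
        rintro _ ⟨x, hx, rfl⟩
        exact hp _ (elim_mem_prodSet hx.1 hx.2)
      have h3 := h1 (CR (zeroLocus k Q)) (Ideal.Quotient.factorₐ k hle)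
        (Ideal.Quotient.factor_surjective hle) (fun f => ?_)
      · have h4 : (dm (zeroLocus k Q) : Cardinal) ≤ 1 := (dm_cast _).trans_le h3
        exact_mod_cast h4
      · have h5 : (Ideal.Quotient.factorₐ k hle).comp (sumHom E) =
            (Algebra.ofId k _).comp (aeval q : MvPolynomial (Fin N) k →ₐ[k] k) := by
          ext i
          simp only [AlgHom.comp_apply, aeval_X]
          have : (X (.inl i) + X (.inr i) - MvPolynomial.C (q i) :
              MvPolynomial (Fin N ⊕ Fin N) k) ∈ vanishingIdeal k (zeroLocus k Q) := by
            rw [hvQ]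
            refine hJQ (mem_vI.2 ?_)
            rintro _ ⟨x, hx, rfl⟩
            simp
          have h6 := Ideal.Quotient.eq_zero_iff_mem.2 this
          rw [map_sub, sub_eq_zero] at h6
          rw [sumHom, AlgHom.comp_apply, aeval_X]
          exact h6
        exact DFunLike.congr_fun h5 f
    · intro x hx
      have hp : (vanishingIdeal k {Sum.elim x (q - x)}).IsPrime :=
        irr_of ⟨_, rfl⟩ fun f g hfg => by simpa using hfg
      obtain ⟨Q, hQ, hQx⟩ := Ideal.exists_minimalPrimes_le (I := J)
        (J := vanishingIdeal k {Sum.elim x (q - x)}) fun p hp' => by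
          rw [mem_vI] at hp' ⊢
          rintro _ rfl
          exact hp' _ ⟨x, hx, rfl⟩
      refine ⟨_, ⟨Q, hQ, rfl⟩, Sum.elim x (q - x), ?_, ?_⟩
      · rw [mem_zeroLocus_iff]
        exact fun p hp' => mem_vI.1 (hQx hp') _ rfl
      · ext i
        simp [pmap, φ]

end SumFibre

section Decomposition

variable {k : Type} [Field k] {n : ℕ}

theorem mem_cn_of_mem_submodule {X : Set (PS k n)} {p : PS k n} (hp : p ∈ X) {x : Fin n → k}
    (hx : x ∈ p.submodule) : x ∈ cn X := by
  induction p using Projectivization.ind with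
  | h v hv =>
    rw [Projectivization.submodule_mk, Submodule.mem_span_singleton] at hx
    obtain ⟨c, rfl⟩ := hx
    exact smul_mem_cn ((mem_cn_iff hv).2 hp) c

theorem mk_eq_of_mem_submodule {p : PS k n} {x : Fin n → k} (hx : x ∈ p.submodule) (hx0 : x ≠ 0) :
    Projectivization.mk k x hx0 = p :=
  (mem_cn_iff hx0).1 (mem_cn_of_mem_submodule (Set.mem_singleton p) hx)

theorem mem_of_memSpan_of_card_lt_two {X : Set (PS k n)} {q : PS k n} {B : Finset (PS k n)}
    (hB : ↑B ⊆ X) (hcard : B.card < 2) (h : memSpan q ↑B) : q ∈ X := by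
  rcases Finset.eq_empty_or_nonempty B with rfl | hne
  · have h1 : q.submodule = ⊥ := by simpa [memSpan, pspan] using h
    have h2 := q.finrank_submodule
    rw [h1, finrank_bot] at h2
    exact absurd h2 zero_ne_one
  · obtain ⟨p, rfl⟩ := Finset.card_eq_one.1 (le_antisymm (Nat.le_of_lt_succ hcard) hne.card_pos)
    have h1 : q ∈ linSet p.submodule := by simpa [memSpan, pspan, linSet] using h
    rw [← singleton_eq_linSet] at h1
    exact hB (by simpa using h1)

theorem exists_of_memSpan_of_card_eq_two {q : PS k n} {A : Finset (PS k n)}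
    (hcard : A.card = 2) (h : memSpan q ↑A) {w : Fin n → k} (hw : w ∈ q.submodule) :
    ∃ p₁ p₂ : PS k n, (↑A : Set (PS k n)) = {p₁, p₂} ∧ ∃ x ∈ p₁.submodule, ∃ y ∈ p₂.submodule,
        x + y = w := by
  classical
  obtain ⟨p₁, p₂, -, rfl⟩ := Finset.card_eq_two.1 hcard
  refine ⟨p₁, p₂, by simp, Submodule.mem_sup.1 ?_⟩
  have h1 := h hw
  rwa [Finset.coe_pair, pspan, iSup_pair] at h1

section Fibre

variable {X : Set (PS k n)} {w : Fin n → k}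

theorem sumFibre_spec (hw : w ∉ cn X) {x : Fin n → k} (hx : x ∈ sumFibre (cn X) w) :
    ∃ (hx0 : x ≠ 0) (hy0 : w - x ≠ 0),
      Projectivization.mk k x hx0 ≠ Projectivization.mk k (w - x) hy0 := by
  have hx0 : x ≠ 0 := by
    rintro rfl
    exact hw (by simpa using hx.2)
  have hy0 : w - x ≠ 0 := fun h => hw (by rw [sub_eq_zero.1 h]; exact hx.1)
  refine ⟨hx0, hy0, fun h => ?_⟩
  obtain ⟨c, hc⟩ := (Projectivization.mk_eq_mk_iff' k _ _ hx0 hy0).1 h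
  refine hw ?_
  have : w = (1 + c) • (w - x) := by
    rw [add_smul, one_smul, hc, sub_add_cancel]
  rw [this]
  exact smul_mem_cn hx.2 _

theorem sumFibre_symm {x : Fin n → k} (hx : x ∈ sumFibre (cn X) w) : w - x ∈ sumFibre (cn X) w :=
  ⟨hx.2, by simpa using hx.1⟩

theorem exists_decomposition (hw : w ∉ cn X) (hw0 : w ≠ 0) {x : Fin n → k}
    (hx : x ∈ sumFibre (cn X) w) (hx0 : x ≠ 0) :
    ∃ A : Finset (PS k n), ↑A ⊆ X ∧ A.card = 2 ∧ memSpan (Projectivization.mk k w hw0) ↑A ∧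
      Projectivization.mk k x hx0 ∈ A := by
  classical
  obtain ⟨_, hy0, hne⟩ := sumFibre_spec hw hx
  refine ⟨{Projectivization.mk k x hx0, Projectivization.mk k (w - x) hy0}, ?_,
    Finset.card_pair hne, ?_, by simp⟩
  · rw [Finset.coe_pair, Set.pair_subset_iff]
    exact ⟨(mem_cn_iff hx0).1 hx.1, (mem_cn_iff hy0).1 hx.2⟩
  · rw [memSpan, Finset.coe_pair, pspan, iSup_pair, Projectivization.submodule_mk,
      Submodule.span_singleton_le_iff_mem, Submodule.mem_sup]
    exact ⟨x, by simp [Projectivization.submodule_mk], w - x,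
      by simp [Projectivization.submodule_mk], by simp⟩

theorem rk_eq_two (hw : w ∉ cn X) (hw0 : w ≠ 0) (hne : (sumFibre (cn X) w).Nonempty) :
    rk X (Projectivization.mk k w hw0) = 2 := by
  obtain ⟨x, hx⟩ := hne
  obtain ⟨A, hA, hA2, hAs, -⟩ := exists_decomposition hw hw0 hx (sumFibre_spec hw hx).1
  have h2 : 2 ∈ {s | hasDecomp X (Projectivization.mk k w hw0) s} := ⟨A, hA, hA2, hAs⟩
  refine le_antisymm (Nat.sInf_le h2) ?_
  by_contra! hlt
  obtain ⟨B, hB, hBc, hBs⟩ := Nat.sInf_mem ⟨2, h2⟩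
  exact hw ((mem_cn_iff hw0).2 (mem_of_memSpan_of_card_lt_two hB (hBc.trans_lt hlt) hBs))

theorem entryLocus_eq (hw : w ∉ cn X) (hw0 : w ≠ 0) (hne : (sumFibre (cn X) w).Nonempty) :
    entryLocus X (Projectivization.mk k w hw0) = closure (proj (sumFibre (cn X) w)) := by
  have hq : Projectivization.mk k w hw0 ∉ X := fun h => hw ((mem_cn_iff hw0).2 h)
  rw [entryLocus]
  congr 1
  ext p
  simp only [Set.mem_iUnion, exists_prop]
  constructor
  · rintro ⟨A, ⟨hA, hAc, hAs, -⟩, hp⟩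
    rw [rk_eq_two hw hw0 hne] at hAc
    obtain ⟨p₁, p₂, hA', x, hx, y, hy, hxy⟩ := exists_of_memSpan_of_card_eq_two hAc hAs
      (w := w) (by simp [Projectivization.submodule_mk])
    rw [hA'] at hp hA
    have hxF : x ∈ sumFibre (cn X) w := ⟨mem_cn_of_mem_submodule (hA (by simp)) hx, by
      rw [← hxy, add_sub_cancel_left]
      exact mem_cn_of_mem_submodule (hA (by simp)) hy⟩
    have hyF : y ∈ sumFibre (cn X) w := by
      have := sumFibre_symm hxF
      rwa [← hxy, add_sub_cancel_left, hxy] at this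
    rcases hp with rfl | rfl
    · have := (sumFibre_spec hw hxF).1
      exact ⟨x, hxF, this, mk_eq_of_mem_submodule hx this⟩
    · have := (sumFibre_spec hw hyF).1
      exact ⟨y, hyF, this, mk_eq_of_mem_submodule hy this⟩
  · rintro ⟨x, hx, hx0, rfl⟩
    obtain ⟨A, hA, hA2, hAs, hxA⟩ := exists_decomposition hw hw0 hx hx0
    refine ⟨A, ⟨hA, hA2.trans (rk_eq_two hw hw0 hne).symm, hAs, fun B hB hBs => ?_⟩, hxA⟩
    exact hq (mem_of_memSpan_of_card_lt_two ((Finset.coe_subset.2 hB.subset).trans hA)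
      (hA2 ▸ Finset.card_lt_card hB) hBs)

theorem mem_cn_of_infinite_line (hX : IsClosed X) {x : Fin n → k}
    (h : {c : k | w - c • x ∈ cn X}.Infinite) : w ∈ cn X := by
  refine mem_cn_of_forall hX fun p hp => ?_
  let Q : Polynomial k := aeval (fun i => Polynomial.C (w i) - Polynomial.X * Polynomial.C (x i)) p
  have hQ : ∀ c, Q.eval c = eval (w - c • x) p := by
    intro c
    rw [← Polynomial.coe_aeval_eq_eval, ← aeval_eq_eval]
    simp only [Q]
    rw [MvPolynomial.comp_aeval_apply]
    congr 2
    ext i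
    simp only [map_sub, map_mul, Polynomial.aeval_C, Polynomial.aeval_X, Pi.sub_apply,
      Pi.smul_apply, smul_eq_mul]
    rfl
  have h0 : Q = 0 := Polynomial.eq_zero_of_infinite_isRoot Q (h.mono fun c hc => by
    rw [Set.mem_ofPred_eq, Polynomial.IsRoot, hQ]
    exact hp _ hc)
  have := hQ 0
  rw [h0, Polynomial.eval_zero, zero_smul, sub_zero] at this
  exact this.symm

theorem dm_cn_proj_le [Infinite k] (G : Set (Fin n →
    k)) (hG : Irr G) : dm (cn (proj G)) ≤ dm G + 1 := by
  have h1 := dm_prodSet hG (irr_univ (k := k) (σ := Unit))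
  have h2 := dm_image_le (fun j : Fin n => X (.inr ()) * X (.inl j))
    (prodSet G (Set.univ : Set (Unit → k)))
  rw [h1, dm_univ, Nat.card_unique] at h2
  refine le_trans (dm_mono fun p hp v hv => ?_) h2
  have key : ∀ g ∈ G, ∀ c : k, eval (c • g) p = 0 := fun g hg c => by
    refine hp _ ⟨Sum.elim g (fun _ => c), elim_mem_prodSet hg trivial, ?_⟩
    ext j
    simp [pmap]
  by_cases hv0 : v = 0
  · obtain ⟨g, hg⟩ := hG.nonempty
    simpa [hv0] using key g hg 0
  · obtain ⟨g, hg, hg0, hgv⟩ := hv hv0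
    obtain ⟨c, rfl⟩ := (Projectivization.mk_eq_mk_iff' k _ _ hv0 hg0).1 hgv.symm
    exact key g hg c

end Fibre

theorem dm_cn_le_two_of_subset [Infinite k] {F : Set (Fin n → k)} {𝒢 : Set (Set (Fin n → k))}
    (hfin : 𝒢.Finite) (h𝒢 : ∀ G ∈ 𝒢, Irr G ∧ dm G ≤ 1) (hF : F ⊆ ⋃₀ 𝒢) {Z : Set (PS k n)}
    (hZ : Z ⊆ closure (proj F)) (hZi : IsIrreducible Z) : dm (cn Z) ≤ 2 := by
  have hfin' := hfin.image fun G => closure (proj G)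
  have hsub : closure (proj F) ⊆ ⋃₀ ((fun G => closure (proj G)) '' 𝒢) := by
    rw [Set.sUnion_image]
    refine closure_minimal ?_ (hfin.isClosed_biUnion fun _ _ => isClosed_closure)
    rintro _ ⟨v, hv, hv0, rfl⟩
    obtain ⟨G, hG, hvG⟩ := hF hv
    exact Set.mem_biUnion hG (subset_closure ⟨v, hvG, hv0, rfl⟩)
  obtain ⟨_, hT, hZT⟩ := (isIrreducible_iff_sUnion_isClosed.1 hZi) hfin'.toFinset
    (by
      intro t ht
      obtain ⟨G, -, rfl⟩ := hfin'.mem_toFinset.1 ht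
      exact isClosed_closure)
    (by rw [Set.Finite.coe_toFinset]; exact hZ.trans hsub)
  obtain ⟨G, hG, rfl⟩ := hfin'.mem_toFinset.1 hT
  obtain ⟨hGi, hG1⟩ := h𝒢 G hG
  exact (dm_cn_mono hZT).trans ((dm_cn_closure (proj G)).trans_le
    ((dm_cn_proj_le G hGi).trans (Nat.succ_le_succ hG1)))

/-- A point of a finite component has an open neighbourhood meeting the whole set only there. -/
theorem exists_isOpen_of_finite_comp {Y C : Set (PS k n)} (hY : IsClosed Y) (hC : IsCompOf C Y)
    (hfin : C.Finite) : ∃ y ∈ C, ∃ U, IsOpen U ∧ y ∈ U ∧ Y ∩ U ⊆ {y} := by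
  obtain ⟨hcf, hcov⟩ := exists_finite_comps hY
  have hfin' := hcf.subset (Set.sdiff_subset (t := {C}))
  have hcl : ∀ t ∈ {C | IsCompOf C Y} \ {C}, IsClosed t := fun t ht => ht.1.isClosed hY
  have hne : ¬ C ⊆ ⋃₀ ({C | IsCompOf C Y} \ {C}) := fun h => by
    obtain ⟨t, ht, hCt⟩ := (isIrreducible_iff_sUnion_isClosed.1 hC.1.2) hfin'.toFinset
      (fun t ht => hcl t (hfin'.mem_toFinset.1 ht)) (by rwa [Set.Finite.coe_toFinset])
    have ht' := hfin'.mem_toFinset.1 ht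
    exact ht'.2 (hC.eq_of_subset ht'.1.1 hCt).symm
  obtain ⟨y, hyC, hy⟩ := Set.not_subset.1 hne
  refine ⟨y, hyC, (⋃₀ ({C | IsCompOf C Y} \ {C}) ∪ (C \ {y}))ᶜ,
    ((Set.sUnion_eq_biUnion ▸ hfin'.isClosed_biUnion hcl).union (hfin.subset
        Set.sdiff_subset).isClosed).isOpen_compl, ?_, ?_⟩
  · simp only [Set.mem_compl_iff, Set.mem_union, not_or]
    exact ⟨hy, fun h => h.2 rfl⟩
  · rintro z ⟨hzY, hz⟩
    simp only [Set.mem_compl_iff, Set.mem_union, not_or] at hz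
    by_contra hzy
    obtain ⟨D, hD, hzD⟩ := hcov z hzY
    by_cases hDC : D = C
    · exact hz.2 ⟨hDC ▸ hzD, hzy⟩
    · exact hz.1 ⟨D, ⟨hD, hDC⟩, hzD⟩

theorem infinite_of_isCompOf {X : Set (PS k n)} (hX : IsClosed X) {w : Fin n → k} (hw : w ∉ cn X)
    (h : ∀ x ∈ sumFibre (cn X) w, ∀ g : MvPolynomial (Fin n) k, eval x g ≠ 0 →
      {y | y ∈ sumFibre (cn X) w ∧ eval y g ≠ 0}.Infinite)
    {C : Set (PS k n)} (hC : IsCompOf C (closure (proj (sumFibre (cn X) w)))) : C.Infinite := by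
  intro hfin
  obtain ⟨y, hyC, U, hU, hyU, hYU⟩ := exists_isOpen_of_finite_comp isClosed_closure hC hfin
  obtain ⟨z, hzU, hz⟩ := mem_closure_iff.1 (hC.1.1 hyC) U hU hyU
  obtain ⟨x, hx, hx0, rfl⟩ := hz
  obtain ⟨d, g, -, hgx, hg⟩ := exists_homog_of_isOpen hU hx0 hzU
  have hline : ∀ x' ∈ {y | y ∈ sumFibre (cn X) w ∧ eval y g ≠ 0}, ∃ c : k, c • x = x' := by
    rintro x' ⟨hx', hgx'⟩
    have hx'0 := (sumFibre_spec hw hx').1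
    have h1 : Projectivization.mk k x' hx'0 = y :=
      hYU ⟨subset_closure ⟨x', hx', hx'0, rfl⟩, hg _ hx'0 hgx'⟩
    have h2 : Projectivization.mk k x hx0 = y := hYU ⟨subset_closure ⟨x, hx, hx0, rfl⟩, hzU⟩
    exact (Projectivization.mk_eq_mk_iff' k _ _ hx'0 hx0).1 (h1.trans h2.symm)
  choose! c hc using hline
  refine hw (mem_cn_of_infinite_line hX (x := x)
    (Set.infinite_of_injOn_mapsTo (f := c) ?_ ?_ (h x hx g hgx)))
  · intro x₁ h₁ x₂ h₂ h12
    rw [← hc x₁ h₁, ← hc x₂ h₂, h12]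
  · intro x' hx'
    change w - c x' • x ∈ cn X
    rw [hc x' hx']
    exact hx'.1.2

end Decomposition

section General

variable {k : Type} [Field k] {n : ℕ}

theorem eq_zero_of_vanish_add [Infinite k] {X : Set (PS k n)} (hsec : secant X 2 = Set.univ)
    {f : MvPolynomial (Fin n) k} (hf : ∀ x ∈ cn X, ∀ y ∈ cn X, eval (x + y) f = 0) : f = 0 := by
  have h1 : ∀ v ∈ cn {q | hasDecomp X q 2}, eval v f = 0 := by
    intro v hv
    by_cases hv0 : v = 0
    · simpa [hv0] using hf 0 (zero_mem_cn X) 0 (zero_mem_cn X)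
    · obtain ⟨A, hA, hA2, hAs⟩ := hv hv0
      obtain ⟨p₁, p₂, hA', x, hx, y, hy, rfl⟩ := exists_of_memSpan_of_card_eq_two hA2 hAs
        (w := v) (by simp [Projectivization.submodule_mk])
      rw [hA'] at hA
      exact hf x (mem_cn_of_mem_submodule (hA (by simp)) hx) y
        (mem_cn_of_mem_submodule (hA (by simp)) hy)
  have h2 := vanish_cn_closure h1
  refine MvPolynomial.funext fun v => ?_
  rw [map_zero]
  refine h2 v fun hv => ?_
  change _ ∈ secant X 2
  rw [hsec]
  trivial

theorem exists_vanish_of_dm_lt [Infinite k] {X : Set (PS k n)} (h : dm (cn X) < n) :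
    ∃ p : MvPolynomial (Fin n) k, p ≠ 0 ∧ ∀ x ∈ cn X, eval x p = 0 := by
  by_contra! hcon
  have h1 : dm (Set.univ : Set (Fin n → k)) ≤ dm (cn X) := dm_mono fun p hp => by
    by_contra hne
    obtain ⟨x, hx, hxp⟩ := hcon p fun h0 => hne fun x _ => by simp [h0]
    exact hxp (hp x hx)
  rw [dm_univ, Nat.card_fin] at h1
  omega

/-- A nonvanishing condition on the cone, together with avoiding a small closed set, is generic. -/
theorem generic_of_eval_ne_zero [Infinite k] {V : Set (PS k (n + 1))} (hX : IsClosed V)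
    (hdm : dm (cn V) < n + 1) {a : MvPolynomial (Fin (n + 1)) k} (ha : a ≠ 0)
    {P : PS k (n + 1) → Prop}
    (hP : ∀ (w : Fin (n + 1) → k) (hw0 : w ≠ 0), w ∉ cn V → eval w a ≠ 0 →
      P (Projectivization.mk k w hw0)) : Generic P := by
  obtain ⟨d, hd⟩ : ∃ d, homogeneousComponent d a ≠ 0 := by
    by_contra! hcon
    exact ha (by rw [← sum_homogeneousComponent a]; exact Finset.sum_eq_zero fun d _ => hcon d)
  have hdh := homogeneousComponent_isHomogeneous d a
  obtain ⟨b, hb, hbX⟩ := exists_vanish_of_dm_lt hdm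
  refine ⟨(V0 (homogeneousComponent d a))ᶜ ∩ Vᶜ,
    (isClosed_V0 hdh).isOpen_compl.inter hX.isOpen_compl, ?_, ?_⟩
  · rw [dense_iff_inter_open]
    rintro W hW ⟨q, hq⟩
    induction q using Projectivization.ind with
    | h v hv =>
      obtain ⟨e, f, -, hfv, hf⟩ := exists_homog_of_isOpen hW hv hq
      have hf0 : f ≠ 0 := by
        rintro rfl
        exact hfv (map_zero _)
      have hne : f * homogeneousComponent d a * b * X 0 ≠ 0 :=
        mul_ne_zero (mul_ne_zero (mul_ne_zero hf0 hd) hb) (X_ne_zero 0)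
      obtain ⟨w, hw⟩ : ∃ w, eval w (f * homogeneousComponent d a * b * X 0) ≠ 0 := by
        by_contra! hcon
        exact hne (MvPolynomial.funext fun w => by rw [hcon, map_zero])
      simp only [map_mul, eval_X, mul_ne_zero_iff] at hw
      obtain ⟨⟨⟨h1, h2⟩, h3⟩, h4⟩ := hw
      have hw0 : w ≠ 0 := by
        rintro rfl
        exact h4 rfl
      refine ⟨Projectivization.mk k w hw0, hf w hw0 h1, ?_, fun h => ?_⟩
      · rwa [Set.mem_compl_iff, mem_V0_iff hdh]
      · exact h3 (hbX w ((mem_cn_iff hw0).2 h))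
  · rintro q ⟨hqa, hqX⟩
    induction q using Projectivization.ind with
    | h v hv =>
      rw [Set.mem_compl_iff, mem_V0_iff hdh] at hqa
      obtain ⟨c, hc0, hc⟩ : ∃ c : k, c ≠ 0 ∧ eval (c • v) a ≠ 0 := by
        by_contra! hcon
        refine hqa ?_
        have h0 := eval_zero_of_punctured_line hcon
        have := eval_homogeneousComponent (E := Set.range fun c : k => c • v) (f := a)
          (by rintro _ ⟨c, rfl⟩ c'; exact ⟨c' * c, by simp [mul_smul]⟩)
          (by
            rintro _ ⟨c, rfl⟩
            by_cases hc : c = 0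
            · simpa [hc] using h0
            · exact hcon c hc) d
        exact this v ⟨1, one_smul _ _⟩
      have hcv : c • v ≠ 0 := smul_ne_zero hc0 hv
      rw [← mk_smul hv hcv]
      refine hP _ hcv (fun h => hqX ?_) hc
      rw [← mk_smul hv hcv]
      exact h hcv

end General

end EL

open EL in
/-- For an `n`-dimensional integral nondegenerate `X ⊂ ℙ^{2n}` with
`σ₂(X) = ℙ^{2n}` and general `q`, the Segre locus of the entry locus `Γ_q(X)` has
dimension at most 2, and every 2-dimensional irreducible component of it is a plane
spanned by the union of the components of `Γ_q(X)` contained in it. -/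
theorem statement4 {k : Type} [Field k] [IsAlgClosed k] [CharZero k]
    (n : ℕ) (hn : 2 ≤ n) (X : Set (PS k (2*n+1)))
    (hX : IsVariety X) (hnd : Nondeg X) (hdim : pdim X = (n : WithBot ℕ∞))
    (hsec : secant X 2 = Set.univ) :
    Generic (fun q : PS k (2*n+1) =>
      pdim (segreLocus (entryLocus X q)) ≤ 2 ∧
      ∀ Pl : Set (PS k (2*n+1)),
        Maximal (fun Z => Z ⊆ segreLocus (entryLocus X q) ∧ IsIrreducible Z) Pl →
        pdim Pl = 2 →
        IsLin Pl 2 ∧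
        Pl = linSet (pspan (⋃₀ {C | IsCompOf C (entryLocus X q) ∧ C ⊆ Pl}))) := by
  have hadd := fun f => eq_zero_of_vanish_add (f := f) hsec
  have hE := irr_cn hX.2
  have h1 := dm_cn_le_of_pdim hX.1 hX.2 hdim
  have h2 := le_of_sum_dominant hE hadd
  obtain ⟨a, ha, H⟩ := sum_fibre hE (fun v => mem_cn_of_forall hX.1) (by omega) hadd
  refine generic_of_eval_ne_zero hX.1 (by omega) ha fun w hw0 hw hwa => ?_
  obtain ⟨hne, hinf, 𝒢, hfin, h𝒢, hsub⟩ := H w hwa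
  rw [entryLocus_eq hw hw0 hne]
  exact segreLocus_dim_and_planes isClosed_closure
    (fun Z => dm_cn_le_two_of_subset hfin h𝒢 hsub) fun C => infinite_of_isCompOf hX.1 hw hinf
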